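/- Assume the continuum hypothesis, 2^ℵ₀ = ℵ₁. Then every abelian group that has a Souslin code and is a Whitehead group is a free abelian group. -/

import Mathlib

open MeasureTheory Cardinal

/-- Cantor space: `ℕ → Bool` with the product topology. Its product measurable-space
structure coincides with the Borel σ-algebra of the product topology. -/
abbrev Cantor : Type := ℕ → Bool

/-- A Souslin code for an abelian group `B`: an analytic set `Bstar ⊆ Cantor`, an analytic
set `E ⊆ Cantor × Cantor` whose restriction to `Bstar × Bstar` is an equivalence relation,
and a surjection `q : Bstar → B` inducing the group structure, such that the graph of
addition is analytic. -/
structure SouslinCode (B : Type*) [AddCommGroup B] where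
  Bstar : Set Cantor
  E : Set (Cantor × Cantor)
  q : Cantor → B
  analytic_Bstar : AnalyticSet Bstar
  analytic_E : AnalyticSet E
  refl : ∀ x ∈ Bstar, (x, x) ∈ E
  symm : ∀ x ∈ Bstar, ∀ y ∈ Bstar, (x, y) ∈ E → (y, x) ∈ E
  trans : ∀ x ∈ Bstar, ∀ y ∈ Bstar, ∀ z ∈ Bstar, (x, y) ∈ E → (y, z) ∈ E → (x, z) ∈ E
  surj : ∀ b : B, ∃ x ∈ Bstar, q x = b
  q_eq_iff : ∀ x ∈ Bstar, ∀ y ∈ Bstar, (q x = q y ↔ (x, y) ∈ E)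
  analytic_add : AnalyticSet {p : Cantor × Cantor × Cantor |
    p.1 ∈ Bstar ∧ p.2.1 ∈ Bstar ∧ p.2.2 ∈ Bstar ∧ q p.1 + q p.2.1 = q p.2.2}

/-- An abelian group has a Souslin code. -/
def HasSouslinCode (B : Type*) [AddCommGroup B] : Prop := Nonempty (SouslinCode B)

/-- An abelian group `G` is a Whitehead group if for every abelian group `H` and every
surjective homomorphism `f : H → G` whose kernel is isomorphic to `ℤ`, `f` has a
right inverse which is a homomorphism (equivalently, `Ext¹(G, ℤ) = 0`). -/
def IsWhitehead (G : Type*) [AddCommGroup G] : Prop :=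
  ∀ (H : Type*) [AddCommGroup H] (f : H →+ G), Function.Surjective f →
    Nonempty (f.ker ≃+ ℤ) → ∃ s : G →+ H, f.comp s = AddMonoidHom.id G

/-- Every homomorphism to `ℚ/ℤ` lifts to `ℚ`, that is, `Ext¹(G, ℤ) = 0` computed by the injective
resolution `ℚ → ℚ/ℤ` of `ℤ`. -/
def LiftsCharacters (G : Type*) [AddCommGroup G] : Prop :=
  ∀ χ : G →+ AddCircle (1 : ℚ), ∃ ψ : G →+ ℚ, ∀ g, (ψ g : AddCircle (1 : ℚ)) = χ g

/-- `Hom(C/A, ℤ) = 0`, where homomorphisms on `C` are given as restrictions of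
homomorphisms into the injective group `ℚ`. -/
def NoIntHom {G : Type*} [AddCommGroup G] (A C : AddSubgroup G) : Prop :=
  ∀ g : G →+ ℚ, (∀ a ∈ A, g a = 0) → (∀ c ∈ C, ∃ z : ℤ, g c = z) → ∀ c ∈ C, g c = 0

section Characters

variable {G : Type*} [AddCommGroup G]

lemma exists_extension_of_divisible {Q : Type*} [AddCommGroup Q] [DivisibleBy Q ℤ]
    (C : AddSubgroup G) (g : C →+ Q) : ∃ h : G →+ Q, ∀ c : C, h c = g c := by
  obtain ⟨h, hh⟩ := (Module.Baer.of_divisible Q).extension_property_addMonoidHom C.subtype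
    C.subtype_injective g
  exact ⟨h, fun c ↦ DFunLike.congr_fun hh c⟩

lemma exists_character_of_notMem {H : AddSubgroup G} {d : G} (hd : d ∉ H) :
    ∃ χ : G →+ AddCircle (1 : ℚ), (∀ h ∈ H, χ h = 0) ∧ χ d ≠ 0 := by
  have hne : (QuotientAddGroup.mk' H d) ≠ 0 := by simpa using hd
  obtain ⟨c, hc⟩ := CharacterModule.exists_character_apply_ne_zero_of_ne_zero hne
  let c' : (G ⧸ H) →+ AddCircle (1 : ℚ) := c
  refine ⟨c'.comp (QuotientAddGroup.mk' H), fun h hh ↦ ?_, hc⟩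
  have : QuotientAddGroup.mk' H h = 0 := by simpa using hh
  simp only [AddMonoidHom.comp_apply, this, map_zero]

lemma coe_eq_zero_iff_int {x : ℚ} : (x : AddCircle (1 : ℚ)) = 0 ↔ ∃ z : ℤ, x = z := by
  rw [AddCircle.coe_eq_zero_iff]
  simp [eq_comm]

lemma exists_int_hom {g : G →+ ℚ} (hg : ∀ x, ∃ z : ℤ, g x = z) :
    ∃ f : G →+ ℤ, ∀ x, g x = f x := by
  choose f hf using hg
  refine ⟨AddMonoidHom.mk' f fun a b ↦ ?_, hf⟩
  have := map_add g a b
  rw [hf, hf, hf] at this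
  exact_mod_cast this

/-- A group with neither homomorphisms nor extensions to `ℤ` is trivial. -/
lemma eq_zero_of_liftsCharacters (hl : LiftsCharacters G) (h0 : ∀ g : G →+ ℤ, g = 0) (d : G) :
    d = 0 := by
  have hint : ∀ g : G →+ ℚ, (∀ x, (g x : AddCircle (1 : ℚ)) = 0) → g = 0 := by
    intro g hg
    obtain ⟨f, hf⟩ := exists_int_hom fun x ↦ coe_eq_zero_iff_int.1 (hg x)
    ext x
    simp [hf, h0 f]
  have hchar : ∀ d : G, d ≠ 0 → ∃ χ : G →+ AddCircle (1 : ℚ), χ d ≠ 0 := fun d hd ↦ by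
    obtain ⟨χ, -, h⟩ := exists_character_of_notMem (H := ⊥) (d := d) (by simpa using hd)
    exact ⟨χ, h⟩
  have htf : ∀ (n : ℕ) (d : G), n ≠ 0 → n • d = 0 → d = 0 := by
    intro n d hn hd
    by_contra hne
    obtain ⟨χ, hχ⟩ := hchar d hne
    obtain ⟨ψ, hψ⟩ := hl χ
    have h1 : (n : ℚ) * ψ d = 0 := by
      rw [← nsmul_eq_mul, ← map_nsmul, hd, map_zero]
    have h2 : ψ d = 0 := by simpa [hn] using h1
    exact hχ (by rw [← hψ, h2]; simp)
  have hdiv : ∀ (n : ℕ) (d : G), n ≠ 0 → ∃ e, n • e = d := by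
    intro n d hn
    by_contra! hne
    obtain ⟨χ, hχ, hχd⟩ := exists_character_of_notMem (H := (nsmulAddMonoidHom (α := G) n).range)
      (d := d) (by rintro ⟨e, he⟩; exact hne e he)
    obtain ⟨ψ, hψ⟩ := hl χ
    have h1 : n • ψ = 0 := by
      refine hint _ fun x ↦ ?_
      have h2 : ((n • ψ x : ℚ) : AddCircle (1 : ℚ)) = χ (n • x) := by
        rw [← map_nsmul, hψ]
      rw [AddMonoidHom.nsmul_apply, h2]
      exact hχ _ ⟨x, rfl⟩
    have h2 : ψ d = 0 := by
      have := DFunLike.congr_fun h1 d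
      simpa [hn] using this
    exact hχd (by rw [← hψ, h2]; simp)
  by_contra hd
  let H : AddSubgroup G :=
    { carrier := {x | ∃ (n : ℕ) (z : ℤ), (2 ^ n : ℕ) • x = z • d}
      zero_mem' := ⟨0, 0, by simp⟩
      add_mem' := by
        rintro x y ⟨n, z, hx⟩ ⟨m, w, hy⟩
        refine ⟨n + m, 2 ^ m * z + 2 ^ n * w, ?_⟩
        have e1 : (2 ^ (n + m) : ℕ) • x = ((2 : ℤ) ^ m * z) • d := by
          rw [pow_add, mul_comm, mul_nsmul', hx, mul_zsmul']
          rw [← natCast_zsmul, ← mul_zsmul', ← mul_zsmul']; push_cast; congr 1; ring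
        have e2 : (2 ^ (n + m) : ℕ) • y = ((2 : ℤ) ^ n * w) • d := by
          rw [pow_add, mul_nsmul', hy, mul_zsmul']
          rw [← natCast_zsmul, ← mul_zsmul', ← mul_zsmul']; push_cast; congr 1; ring
        rw [nsmul_add, e1, e2, add_zsmul]
      neg_mem' := by
        rintro x ⟨n, z, hx⟩
        exact ⟨n, -z, by rw [smul_neg, hx, neg_zsmul]⟩ }
  obtain ⟨e, he⟩ := hdiv 3 d (by norm_num)
  have heH : e ∉ H := by
    rintro ⟨n, z, h⟩
    have h1 : ((2 : ℤ) ^ n - 3 * z) • e = 0 := by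
      rw [sub_zsmul, mul_comm (3 : ℤ), mul_zsmul]
      have h3 : (3 : ℤ) • e = d := by rw [← he]; exact_mod_cast natCast_zsmul e 3
      rw [h3, ← h, ← natCast_zsmul]
      simp
    have hk : (2 : ℤ) ^ n - 3 * z ≠ 0 := by
      intro h0
      have h4 : (3 : ℤ) ∣ 2 ^ n := ⟨z, by linarith⟩
      have := Int.Prime.dvd_pow' (by norm_num : Nat.Prime 3) h4
      norm_num at this
    have h5 : ((2 : ℤ) ^ n - 3 * z).natAbs • e = 0 := by
      rcases Int.natAbs_eq ((2 : ℤ) ^ n - 3 * z) with h | h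
      · rw [← natCast_zsmul, ← h, h1]
      · have : (-(((2 : ℤ) ^ n - 3 * z).natAbs : ℤ)) • e = 0 := by rw [← h, h1]
        rwa [neg_zsmul, neg_eq_zero, natCast_zsmul] at this
    have h6 := htf _ _ (by simpa using hk) h5
    exact hd (by rw [← he, h6]; simp)
  obtain ⟨χ, hχ, hχe⟩ := exists_character_of_notMem heH
  obtain ⟨ψ, hψ⟩ := hl χ
  have hψH : ∀ x ∈ H, ∃ z : ℤ, ψ x = z := fun x hx ↦
    coe_eq_zero_iff_int.1 (by rw [hψ, hχ x hx])
  obtain ⟨c, hc⟩ := hψH d ⟨0, 1, by simp⟩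
  have hc0 : c = 0 := by
    by_contra hne
    obtain ⟨n, hn⟩ : ∃ n : ℕ, c.natAbs < 2 ^ n := ⟨c.natAbs, Nat.lt_two_pow_self⟩
    obtain ⟨x, hx⟩ := hdiv (2 ^ n) d (by positivity)
    obtain ⟨z, hz⟩ := hψH x ⟨n, 1, by simpa using hx⟩
    have : ((2 : ℚ) ^ n) * z = c := by
      rw [← hc, ← hx, map_nsmul, hz]; simp
    have h1 : ((2 : ℤ) ^ n) * z = c := by exact_mod_cast this
    have h2 : (2 ^ n : ℕ) ∣ c.natAbs := by
      have := Int.natAbs_dvd_natAbs.2 (Dvd.intro z h1)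
      simpa [Int.natAbs_pow] using this
    have := Nat.le_of_dvd (by omega) h2
    omega
  have : (3 : ℚ) * ψ e = 0 := by
    have : ψ (3 • e) = 0 := by rw [he, hc, hc0]; simp
    simpa using this
  have hψe : ψ e = 0 := by simpa using this
  exact hχe (by rw [← hψ, hψe]; simp)

lemma exists_character_not_lift {V U : AddSubgroup G} (hVU : ¬U ≤ V) (h : NoIntHom V U) :
    ∃ χ : G →+ AddCircle (1 : ℚ), (∀ v ∈ V, χ v = 0) ∧
      ¬∃ ψ : G →+ ℚ, (∀ v ∈ V, ψ v = 0) ∧ ∀ u ∈ U, (ψ u : AddCircle (1 : ℚ)) = χ u := by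
  by_contra! hcon
  refine hVU fun u hu ↦ ?_
  let p := QuotientAddGroup.mk' V
  let D := U.map p
  have hpV : ∀ v ∈ V, p v = 0 := fun v hv ↦ by simpa [p] using hv
  have hmem : ∀ u ∈ U, p u ∈ D := fun u hu ↦ ⟨u, hu, rfl⟩
  suffices hD : (⟨p u, hmem u hu⟩ : D) = 0 by
    have := congrArg Subtype.val hD
    simpa [p] using this
  refine eq_zero_of_liftsCharacters (fun χ ↦ ?_) (fun g ↦ ?_) _
  · obtain ⟨χ', hχ'⟩ := exists_extension_of_divisible D χ
    obtain ⟨ψ, hψV, hψ⟩ := hcon (χ'.comp p) fun v hv ↦ by simp [hpV v hv]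
    let ψ' : (G ⧸ V) →+ ℚ := QuotientAddGroup.lift V ψ hψV
    refine ⟨ψ'.comp D.subtype, ?_⟩
    rintro ⟨_, u, hu, rfl⟩
    rw [← hχ']
    exact hψ u hu
  · let g' : D →+ ℚ := (Int.castAddHom ℚ).comp g
    obtain ⟨g'', hg''⟩ := exists_extension_of_divisible D g'
    have := h (g''.comp p) (fun v hv ↦ by simp [hpV v hv])
      fun u hu ↦ ⟨g ⟨p u, hmem u hu⟩, hg'' ⟨p u, hmem u hu⟩⟩
    ext ⟨_, u, hu, rfl⟩
    have h1 : ((g ⟨p u, hmem u hu⟩ : ℤ) : ℚ) = 0 := (hg'' ⟨p u, hmem u hu⟩).symm.trans (this u hu)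
    exact_mod_cast h1

lemma LiftsCharacters.eq_bot_of_noIntHom (hl : LiftsCharacters G) {C : AddSubgroup G}
    (hC : NoIntHom ⊥ C) : C = ⊥ := by
  by_contra hne
  obtain ⟨χ, -, hχ⟩ := exists_character_not_lift (fun h ↦ hne (le_bot_iff.1 h)) hC
  obtain ⟨ψ, hψ⟩ := hl χ
  exact hχ ⟨ψ, by simp, fun u _ ↦ hψ u⟩

end Characters

section Radical

universe u

variable {G : Type*} [AddCommGroup G]

lemma exists_wellOrder_countable_Iio {α : Type*} (h : #α ≤ ℵ₁) :
    ∃ (_ : LinearOrder α) (_ : WellFoundedLT α), ∀ a : α, (Set.Iio a).Countable := by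
  obtain ⟨i, w, hα⟩ := exists_ord_eq_type_lt α
  refine ⟨i, w, fun a ↦ ?_⟩
  have := (mk_Iio_lt a hα).trans_le h
  rwa [← succ_aleph0, Order.lt_succ_iff, mk_le_aleph0_iff] at this

lemma Set.Countable.addSubgroup_closure {s : Set G} (hs : s.Countable) :
    (AddSubgroup.closure s : Set G).Countable := by
  have := hs.to_subtype
  have h : (AddSubgroup.closure s : Set G) =
      Set.range (Finsupp.linearCombination ℤ ((↑) : s → G)) := by
    rw [← LinearMap.coe_range, Finsupp.range_linearCombination, Subtype.range_coe,
      ← Submodule.coe_toAddSubgroup, Submodule.span_int_eq_addSubgroupClosure]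
  rw [h]
  exact Set.countable_range _

lemma AddSubgroup.countable_sup {H K : AddSubgroup G} (hH : (H : Set G).Countable)
    (hK : (K : Set G).Countable) : ((H ⊔ K : AddSubgroup G) : Set G).Countable := by
  rw [AddSubgroup.sup_eq_closure]
  exact (hH.union hK).addSubgroup_closure

lemma AddSubgroup.countable_iSup {ι : Type*} [Countable ι] {H : ι → AddSubgroup G}
    (hH : ∀ i, (H i : Set G).Countable) : ((⨆ i, H i : AddSubgroup G) : Set G).Countable := by
  rw [AddSubgroup.iSup_eq_closure]
  exact (Set.countable_iUnion hH).addSubgroup_closure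

lemma NoIntHom.self (A : AddSubgroup G) : NoIntHom A A := fun _ hg _ ↦ hg

lemma NoIntHom.mono_left {A V U : AddSubgroup G} (h : NoIntHom A U) (hAV : A ≤ V) :
    NoIntHom V U := fun g hg ↦ h g fun a ha ↦ hg a (hAV ha)

lemma NoIntHom.sup {A C D : AddSubgroup G} (hC : NoIntHom A C) (hD : NoIntHom A D) :
    NoIntHom A (C ⊔ D) := by
  intro g hg hint
  have h : C ⊔ D ≤ g.ker := sup_le
    (fun c hc ↦ hC g hg (fun c hc ↦ hint c (AddSubgroup.mem_sup_left hc)) c hc)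
    (fun c hc ↦ hD g hg (fun c hc ↦ hint c (AddSubgroup.mem_sup_right hc)) c hc)
  exact fun c hc ↦ h hc

lemma NoIntHom.iSup {ι : Type*} {A : AddSubgroup G} {C : ι → AddSubgroup G}
    (hC : ∀ i, NoIntHom A (C i)) : NoIntHom A (⨆ i, C i) := by
  intro g hg hint
  have h : ⨆ i, C i ≤ g.ker := iSup_le fun i c hc ↦
    hC i g hg (fun c hc ↦ hint c (AddSubgroup.mem_iSup_of_mem i hc)) c hc
  exact fun c hc ↦ h hc

/-- The union of all countable `C ≥ A` with `Hom(C/A, ℤ) = 0`. -/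
def intRadical (A : AddSubgroup G) : Set G :=
  {b | ∃ C : AddSubgroup G, (C : Set G).Countable ∧ A ≤ C ∧ b ∈ C ∧ NoIntHom A C}

/-- If `intRadical A` is uncountable, there is a long chain of countable subgroups `U j ≥ A`
with `Hom(U j / A, ℤ) = 0`. -/
lemma exists_noIntHom_chain {J : Type*} [LinearOrder J] [WellFoundedLT J]
    (hJ : ∀ j : J, (Set.Iio j).Countable) {A : AddSubgroup G} (hA : (A : Set G).Countable)
    (hR : ¬(intRadical A).Countable) :
    ∃ U : J → AddSubgroup G, ∀ j, NoIntHom A (U j) ∧ A ≤ U j ∧ (∀ k < j, U k ≤ U j) ∧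
      NoIntHom A (A ⊔ ⨆ k : Set.Iio j, U k) ∧ ¬U j ≤ A ⊔ ⨆ k : Set.Iio j, U k := by
  have hstep : ∀ V : AddSubgroup G, ∃ W : AddSubgroup G, (V : Set G).Countable → A ≤ V →
      NoIntHom A V → (W : Set G).Countable ∧ V ≤ W ∧ NoIntHom A W ∧ ¬W ≤ V := by
    intro V
    by_cases hV : (V : Set G).Countable
    · obtain ⟨b, ⟨C, hC, hAC, hbC, hCA⟩, hbV⟩ : ∃ b ∈ intRadical A, b ∉ V := by
        by_contra! h
        exact hR (hV.mono h)
      exact ⟨V ⊔ C, fun _ _ h ↦ ⟨AddSubgroup.countable_sup hV hC, le_sup_left, h.sup hCA,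
        fun h ↦ hbV (h (AddSubgroup.mem_sup_right hbC))⟩⟩
    · exact ⟨V, fun h ↦ absurd h hV⟩
  choose step hstep using hstep
  let F : (j : J) → ((k : J) → k < j → AddSubgroup G) → AddSubgroup G :=
    fun j u ↦ step (A ⊔ ⨆ k : Set.Iio j, u k.1 k.2)
  let U : J → AddSubgroup G := (wellFounded_lt (α := J)).fix F
  have hU : ∀ j, U j = step (A ⊔ ⨆ k : Set.Iio j, U k) := fun j ↦ WellFounded.fix_eq _ F j
  have main : ∀ j, (U j : Set G).Countable ∧ NoIntHom A (U j) := by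
    intro j
    induction j using WellFoundedLT.induction with
    | ind j ih =>
      have := (hJ j).to_subtype
      rw [hU]
      have := hstep (A ⊔ ⨆ k : Set.Iio j, U k)
        (AddSubgroup.countable_sup hA (AddSubgroup.countable_iSup fun k ↦ (ih k k.2).1))
        le_sup_left ((NoIntHom.self A).sup (NoIntHom.iSup fun k ↦ (ih k k.2).2))
      exact ⟨this.1, this.2.2.1⟩
  refine ⟨U, fun j ↦ ?_⟩
  have := (hJ j).to_subtype
  have hn : NoIntHom A (A ⊔ ⨆ k : Set.Iio j, U k) :=
    (NoIntHom.self A).sup (NoIntHom.iSup fun k ↦ (main k).2)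
  have hs := hstep (A ⊔ ⨆ k : Set.Iio j, U k)
    (AddSubgroup.countable_sup hA (AddSubgroup.countable_iSup fun k ↦ (main k).1))
    le_sup_left hn
  rw [← hU] at hs
  exact ⟨(main j).2, le_sup_left.trans hs.2.1, fun k hk ↦
    (le_iSup (fun k : Set.Iio j ↦ U k) ⟨k, hk⟩).trans (le_sup_right.trans hs.2.1), hn, hs.2.2.2⟩

/-- One diagonalization step: a character on `V` extends so that no lift on `U` restricts
to a given homomorphism on `A`. -/
lemma exists_character_avoiding {A V U : AddSubgroup G} (hVU : V ≤ U) (hne : ¬U ≤ V)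
    (hV : NoIntHom A V) (hU : NoIntHom V U) (φ : G →+ AddCircle (1 : ℚ)) (e : A →+ ℚ) :
    ∃ φ' : G →+ AddCircle (1 : ℚ), (∀ v ∈ V, φ' v = φ v) ∧
      ∀ ψ : G →+ ℚ, (∀ u ∈ U, (ψ u : AddCircle (1 : ℚ)) = φ' u) → ∃ a : A, ψ a ≠ e a := by
  obtain ⟨χ, hχV, hχ⟩ := exists_character_not_lift hne hU
  by_contra! hcon
  obtain ⟨ψ₀, h₀, h₀e⟩ := hcon φ fun _ _ ↦ rfl
  obtain ⟨ψ₁, h₁, h₁e⟩ := hcon (φ + χ) fun v hv ↦ by simp [hχV v hv]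
  refine hχ ⟨ψ₁ - ψ₀, ?_, fun u hu ↦ by simp [h₀ u hu, h₁ u hu]⟩
  refine hV _ (fun a ha ↦ by simp [h₀e ⟨a, ha⟩, h₁e ⟨a, ha⟩]) fun v hv ↦ ?_
  rw [← coe_eq_zero_iff_int]
  simp [h₀ v (hVU hv), h₁ v (hVU hv), hχV v hv]

theorem LiftsCharacters.countable_intRadical {G : Type u} [AddCommGroup G]
    (hch : (𝔠 : Cardinal.{u}) = ℵ₁) (hl : LiftsCharacters G) {A : AddSubgroup G}
    (hA : (A : Set G).Countable) : (intRadical A).Countable := by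
  by_contra hR
  have := hA.to_subtype
  have hcard : #(A →+ ℚ) ≤ ℵ₁ := by
    refine (mk_le_of_injective (DFunLike.coe_injective (F := A →+ ℚ))).trans ?_
    calc #(A → ℚ) = lift.{u} (#ℚ) ^ lift.{0} #A := by simp
      _ ≤ 𝔠 ^ (ℵ₀ : Cardinal.{u}) := by
          refine (power_le_power_right ?_).trans (power_le_power_left continuum_ne_zero ?_)
          · simpa using aleph0_le_continuum
          · simp
      _ = ℵ₁ := continuum_power_aleph0.trans hch
  obtain ⟨_, _, hJ⟩ := exists_wellOrder_countable_Iio hcard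
  obtain ⟨U, hU⟩ := exists_noIntHom_chain hJ hA hR
  let IsAvoiding (K : Set (A →+ ℚ)) (f : G →ₗ.[ℤ] AddCircle (1 : ℚ)) : Prop :=
    IsLowerSet K ∧ (∀ x, x ∈ f.domain ↔ x ∈ A ⊔ ⨆ k : K, U k) ∧ ∀ k ∈ K, ∀ ψ : G →+ ℚ,
      (∀ x : f.domain, (x : G) ∈ U k → (ψ x : AddCircle (1 : ℚ)) = f x) → ∃ a : A, ψ a ≠ k a
  obtain ⟨f, ⟨K, hK, hfK, hf⟩, hmax⟩ := zorn_le₀ {f | ∃ K, IsAvoiding K f} (by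
    intro c hc hchain
    rcases c.eq_empty_or_nonempty with rfl | hne
    · refine ⟨⟨AddSubgroup.toIntSubmodule A, 0⟩,
        ⟨∅, isLowerSet_empty, fun x ↦ by simp; rfl, by simp⟩,
        by simp⟩
    have hd := hchain.directedOn
    refine ⟨LinearPMap.sSup c hd, ⟨{k | ∃ f ∈ c, ∃ K, IsAvoiding K f ∧ k ∈ K}, ?_, ?_, ?_⟩,
      fun f hf ↦ LinearPMap.le_sSup hd hf⟩
    · rintro k l hkl ⟨f, hf, K, hK, hk⟩
      exact ⟨f, hf, K, hK, hK.1 hkl hk⟩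
    · intro x
      rw [LinearPMap.mem_domain_sSup_iff hne]
      constructor
      · rintro ⟨f, hf, hx⟩
        obtain ⟨K, hK⟩ := hc hf
        have hle : ⨆ k : K, U k ≤ ⨆ k : {k | ∃ f ∈ c, ∃ K, IsAvoiding K f ∧ k ∈ K}, U k :=
          iSup_le fun k ↦ le_iSup_of_le ⟨k, f, hf, K, hK, k.2⟩ le_rfl
        exact sup_le_sup_left hle A ((hK.2.1 x).1 hx)
      · intro hx
        rw [← LinearPMap.mem_domain_sSup_iff hne hd]
        have hle : A ⊔ ⨆ k : {k | ∃ f ∈ c, ∃ K, IsAvoiding K f ∧ k ∈ K}, U k ≤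
            (LinearPMap.sSup c hd).domain.toAddSubgroup := by
          refine sup_le (fun a ha ↦ ?_) (iSup_le ?_)
          · obtain ⟨f, hf⟩ := hne
            obtain ⟨K, hK⟩ := hc hf
            exact (LinearPMap.le_sSup hd hf).1 ((hK.2.1 a).2 (AddSubgroup.mem_sup_left ha))
          · rintro ⟨k, f, hf, K, hK, hk⟩ x hx
            exact (LinearPMap.le_sSup hd hf).1 ((hK.2.1 x).2
              (AddSubgroup.mem_sup_right (AddSubgroup.mem_iSup_of_mem ⟨k, hk⟩ hx)))
        exact hle hx
    · rintro k ⟨f, hf, K, hK, hk⟩ ψ hψ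
      refine hK.2.2 k hk ψ fun x hx ↦ ?_
      have hle := LinearPMap.le_sSup hd hf
      exact (hψ ⟨x, hle.1 x.2⟩ hx).trans (hle.2 (x := x) rfl).symm)
  obtain ⟨φ, hφ⟩ := exists_extension_of_divisible f.domain.toAddSubgroup
    (f.toFun.toAddMonoidHom : f.domain →+ AddCircle (1 : ℚ))
  replace hφ : ∀ x : f.domain, φ x = f x := hφ
  by_cases hKu : K = Set.univ
  · obtain ⟨ψ, hψ⟩ := hl φ
    obtain ⟨a, ha⟩ := hf (ψ.comp A.subtype) (hKu ▸ Set.mem_univ _) ψ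
      fun x _ ↦ by rw [hψ, hφ]
    exact ha rfl
  obtain ⟨i, hi, hmin⟩ := (wellFounded_lt (α := A →+ ℚ)).has_min Kᶜ
    (Set.nonempty_compl.2 hKu)
  have hKi : K = Set.Iio i := by
    ext k
    refine ⟨fun hk ↦ ?_, fun hk ↦ ?_⟩
    · by_contra h
      exact hi (hK (not_lt.1 h) hk)
    · by_contra h
      exact hmin k h hk
  subst hKi
  obtain ⟨hUi, hAU, hUmono, hV, hne⟩ := hU i
  have hVU : A ⊔ ⨆ k : Set.Iio i, U k ≤ U i := sup_le hAU (iSup_le fun k ↦ hUmono k k.2)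
  obtain ⟨φ', hφ'V, hφ'⟩ := exists_character_avoiding hVU hne hV (hUi.mono_left le_sup_left) φ i
  let f' : G →ₗ.[ℤ] AddCircle (1 : ℚ) :=
    ⟨AddSubgroup.toIntSubmodule (U i), φ'.toIntLinearMap.comp (Submodule.subtype _)⟩
  have hf'f : ∀ (x : f'.domain), f' x = φ' x := fun _ ↦ rfl
  have hle : f ≤ f' := by
    refine ⟨fun x hx ↦ hVU ((hfK x).1 hx), fun x y hxy ↦ ?_⟩
    rw [hf'f, ← hxy, hφ'V _ ((hfK x).1 x.2), hφ]
  have hf'A : IsAvoiding (Set.Iic i) f' := by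
    refine ⟨isLowerSet_Iic i, fun x ↦ ?_, fun k hk ψ hψ ↦ ?_⟩
    · have : A ⊔ ⨆ k : Set.Iic i, U k = U i := by
        refine le_antisymm (sup_le hAU (iSup_le ?_)) ?_
        · rintro ⟨k, hk⟩
          rcases (show k ≤ i from hk).lt_or_eq with h | rfl
          · exact hUmono k h
          · exact le_rfl
        · exact le_sup_of_le_right (le_iSup (fun k : Set.Iic i ↦ U k) ⟨i, le_rfl⟩)
      rw [this]
      rfl
    · rcases (show k ≤ i from hk).lt_or_eq with h | rfl
      · refine hf k h ψ fun x hx ↦ ?_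
        exact (hψ ⟨x, hle.1 x.2⟩ hx).trans (hle.2 (x := x) rfl).symm
      · exact hφ' ψ fun u hu ↦ hψ ⟨u, hu⟩ hu
  have := (hmax ⟨_, hf'A⟩ hle).1
  exact hne fun x hx ↦ (hfK x).1 (this hx)

end Radical

section Configurations

variable {G : Type*} [AddCommGroup G]

/-- `Sat x (m, l, a)` says that `∑ lᵢ xᵢ - a` is divisible by `m`. -/
def Sat {n : ℕ} (x : Fin n → G) (τ : ℤ × (Fin n → ℤ) × G) : Prop :=
  ∃ y, ∑ i, τ.2.1 i • x i = τ.1 • y + τ.2.2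

/-- The relations `Sat x τ` with constants in `A` exclude every nonzero `k` as the vector of
values at `x` of an integer-valued homomorphism vanishing on `A`. -/
def ExcludesAll {n : ℕ} (A : AddSubgroup G) (x : Fin n → G) : Prop :=
  ∀ k : Fin n → ℤ, k ≠ 0 → ∃ τ : ℤ × (Fin n → ℤ) × G,
    τ.2.2 ∈ A ∧ ¬τ.1 ∣ ∑ i, τ.2.1 i * k i ∧ Sat x τ

lemma ExcludesAll.exists_noIntHom {n : ℕ} {A : AddSubgroup G} {x : Fin n → G}
    (h : ExcludesAll A x) (hA : (A : Set G).Countable) :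
    ∃ C : AddSubgroup G, (C : Set G).Countable ∧ A ≤ C ∧ (∀ i, x i ∈ C) ∧ NoIntHom A C := by
  choose! τ hτA hτ hsat using h
  have hsat' : ∀ k, ∃ y, (k = 0 ∨ (τ k).1 = 0 → y = 0) ∧
      (k ≠ 0 → ∑ i, (τ k).2.1 i • x i = (τ k).1 • y + (τ k).2.2) := by
    intro k
    by_cases hk : k = 0
    · exact ⟨0, fun _ ↦ rfl, fun h ↦ (h hk).elim⟩
    obtain ⟨y, hy⟩ := hsat k hk
    by_cases hm : (τ k).1 = 0
    · exact ⟨0, fun _ ↦ rfl, fun _ ↦ by simp [hy, hm]⟩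
    · exact ⟨y, fun h ↦ by tauto, fun _ ↦ hy⟩
  choose y hy0 hy using hsat'
  let S : Set G := (A : Set G) ∪ (Set.range x ∪ Set.range y)
  have hS : ∀ s ∈ S, s ∈ AddSubgroup.closure S := fun s hs ↦ AddSubgroup.subset_closure hs
  have hx : ∀ i, x i ∈ AddSubgroup.closure S := fun i ↦ hS _ (.inr (.inl ⟨i, rfl⟩))
  have hyS : ∀ k, y k ∈ AddSubgroup.closure S := fun k ↦ hS _ (.inr (.inr ⟨k, rfl⟩))
  refine ⟨AddSubgroup.closure S, Set.Countable.addSubgroup_closure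
    (hA.union ((Set.countable_range x).union (Set.countable_range y))),
    fun a ha ↦ hS _ (.inl ha), hx, fun g hg hint ↦ ?_⟩
  choose k hk using fun i ↦ hint _ (hx i)
  have hk0 : k = 0 := by
    by_contra hk0
    obtain ⟨z, hz⟩ := hint _ (hyS k)
    refine hτ k hk0 ⟨z, ?_⟩
    have := congrArg g (hy k hk0)
    simp only [map_sum, map_add, map_zsmul, hg _ (hτA k hk0), hk, hz, zsmul_eq_mul,
      add_zero] at this
    exact_mod_cast this
  have hgx : ∀ i, g (x i) = 0 := fun i ↦ by simp [hk, hk0]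
  have hgy : ∀ k, g (y k) = 0 := by
    intro k
    by_cases h : k = 0 ∨ (τ k).1 = 0
    · simp [hy0 k h]
    push Not at h
    have := congrArg g (hy k h.1)
    simp only [map_sum, map_add, map_zsmul, hg _ (hτA k h.1), hgx, smul_zero,
      Finset.sum_const_zero, add_zero] at this
    exact (smul_eq_zero.1 this.symm).resolve_left h.2
  have hle : AddSubgroup.closure S ≤ g.ker := by
    rw [AddSubgroup.closure_le]
    rintro s (hs | ⟨i, rfl⟩ | ⟨k, rfl⟩)
    · exact hg s hs
    · exact hgx i
    · exact hgy k
  exact fun c hc ↦ hle hc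

lemma ExcludesAll.mem_intRadical {n : ℕ} {A : AddSubgroup G} {x : Fin n → G}
    (h : ExcludesAll A x) (hA : (A : Set G).Countable) (i : Fin n) : x i ∈ intRadical A := by
  obtain ⟨C, hC, hAC, hx, hn⟩ := h.exists_noIntHom hA
  exact ⟨C, hC, hAC, hx i, hn⟩

lemma ExcludesAll.eq_zero {n : ℕ} {x : Fin n → G} (h : ExcludesAll ⊥ x)
    (hl : LiftsCharacters G) : x = 0 := by
  obtain ⟨C, -, -, hx, hn⟩ := h.exists_noIntHom (by simp)
  rw [hl.eq_bot_of_noIntHom hn] at hx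
  exact funext hx

/-- If all the relations of `x` excluding `k ≠ 0` also hold at `r`, then `x = r`. -/
lemma eq_of_forall_sat {n : ℕ} (hl : LiftsCharacters G) {x r : Fin n → G}
    (h : ∀ k : Fin n → ℤ, k ≠ 0 → ∃ τ : ℤ × (Fin n → ℤ) × G,
      ¬τ.1 ∣ ∑ i, τ.2.1 i * k i ∧ Sat x τ ∧ Sat r τ) : x = r := by
  refine sub_eq_zero.1 (ExcludesAll.eq_zero (fun k hk ↦ ?_) hl)
  obtain ⟨τ, hτ, ⟨y, hy⟩, z, hz⟩ := h k hk
  exact ⟨(τ.1, τ.2.1, 0), by simp, hτ, y - z, by simp [smul_sub, hy, hz]⟩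

end Configurations

section Filtration

variable {R M : Type*} [Ring R] [AddCommGroup M] [Module R M]

lemma exists_free_complement {V U : Submodule R M}
    (h : Module.Free R (U.map V.mkQ)) :
    ∃ W : Submodule R M, Module.Free R W ∧ W ≤ U ∧ U ≤ V ⊔ W ∧ Disjoint V W := by
  let f : U →ₗ[R] U.map V.mkQ := V.mkQ.submoduleMap U
  obtain ⟨s, hs⟩ := Module.projective_lifting_property f LinearMap.id
    (LinearMap.submoduleMap_surjective _ _)
  have hs' : ∀ p, V.mkQ (s p : M) = p := fun p ↦ congrArg Subtype.val (DFunLike.congr_fun hs p)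
  let t : U.map V.mkQ →ₗ[R] M := U.subtype ∘ₗ s
  have ht : Function.Injective t := fun p p' hp ↦ by
    rw [← Subtype.coe_inj, ← hs', ← hs']
    exact congrArg _ hp
  refine ⟨LinearMap.range t, Module.Free.of_equiv (LinearEquiv.ofInjective t ht), ?_, ?_, ?_⟩
  · rintro _ ⟨p, rfl⟩
    exact (s p).2
  · intro u hu
    have : u - t (f ⟨u, hu⟩) ∈ V := by
      refine (Submodule.Quotient.mk_eq_zero V).1 ?_
      rw [← V.mkQ_apply, map_sub, sub_eq_zero]
      exact (hs' (f ⟨u, hu⟩)).symm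
    rw [← sub_add_cancel u (t (f ⟨u, hu⟩))]
    exact Submodule.add_mem_sup this ⟨_, rfl⟩
  · rw [Submodule.disjoint_def]
    rintro _ hV ⟨p, rfl⟩
    have : V.mkQ (s p : M) = 0 := by
      rwa [← LinearMap.mem_ker, V.ker_mkQ]
    rw [hs'] at this
    rw [ZeroMemClass.coe_eq_zero.1 this, map_zero]

lemma free_of_filtration {J : Type*} [LinearOrder J] [WellFoundedLT J] {U : J → Submodule R M}
    (htop : ∀ x, ∃ j, x ∈ U j)
    (hfree : ∀ j, Module.Free R ((U j).map (⨆ k : Set.Iio j, U k).mkQ)) : Module.Free R M := by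
  classical
  choose W hWfree hWU hUW hdisj using fun j ↦ exists_free_complement (hfree j)
  have hinj : Function.Injective (DirectSum.coeLinearMap W) := by
    rw [← LinearMap.ker_eq_bot, LinearMap.ker_eq_bot']
    intro f hf
    by_contra hne
    have hsupp : (DFinsupp.support f).Nonempty := by
      rw [Finset.nonempty_iff_ne_empty, Ne, DFinsupp.support_eq_empty]
      exact hne
    let j := (DFinsupp.support f).max' hsupp
    have hj : j ∈ DFinsupp.support f := Finset.max'_mem _ _
    rw [DirectSum.coeLinearMap_eq_dfinsuppSum, DFinsupp.sum, ← Finset.add_sum_erase _ _ hj] at hf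
    have hV : (f j : M) ∈ ⨆ k : Set.Iio j, U k := by
      rw [eq_neg_of_add_eq_zero_left hf]
      refine neg_mem (sum_mem fun k hk ↦ ?_)
      rw [Finset.mem_erase] at hk
      have hlt : k < j := lt_of_le_of_ne (Finset.le_max' _ _ hk.2) hk.1
      exact Submodule.mem_iSup_of_mem (⟨k, hlt⟩ : Set.Iio j) (hWU k (f k).2)
    have := (Submodule.disjoint_def.1 (hdisj j)) _ hV (f j).2
    rw [DFinsupp.mem_support_toFun] at hj
    exact hj (ZeroMemClass.coe_eq_zero.1 this)
  have hsurj : Function.Surjective (DirectSum.coeLinearMap W) := by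
    rw [← LinearMap.range_eq_top, DirectSum.range_coeLinearMap, eq_top_iff]
    have : ∀ j, U j ≤ ⨆ i, W i := by
      intro j
      induction j using WellFoundedLT.induction with
      | ind j ih =>
        exact (hUW j).trans (sup_le (iSup_le fun k ↦ ih k k.2) (le_iSup W j))
    intro x _
    obtain ⟨j, hj⟩ := htop x
    exact this j hj
  exact Module.Free.of_equiv (LinearEquiv.ofBijective _ ⟨hinj, hsurj⟩)

end Filtration

section Pontryagin

variable {H : Type*} [AddCommGroup H]

/-- A form of Pontryagin's criterion: a tuple all of whose possible nonzero integer values are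
excluded by divisibility relations is zero. -/
def DetectsZero (H : Type*) [AddCommGroup H] : Prop :=
  ∀ (n : ℕ) (x : Fin n → H), (∀ k : Fin n → ℤ, k ≠ 0 → ∃ (m : ℤ) (l : Fin n → ℤ),
    ¬m ∣ ∑ i, l i * k i ∧ ∃ y, ∑ i, l i • x i = m • y) → x = 0

/-- The smallest pure subgroup containing `N`, when `H` is torsion-free. -/
def pureClosure (N : Submodule ℤ H) : Submodule ℤ H :=
  (Submodule.torsion ℤ (H ⧸ N)).comap N.mkQ

lemma mem_pureClosure {N : Submodule ℤ H} {y : H} :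
    y ∈ pureClosure N ↔ ∃ m : ℤ, m ≠ 0 ∧ m • y ∈ N := by
  have h : ∀ m : ℤ, m • N.mkQ y = 0 ↔ m • y ∈ N := fun m ↦ by
    rw [← map_zsmul, Submodule.mkQ_apply, Submodule.Quotient.mk_eq_zero]
  simp only [pureClosure, Submodule.mem_comap, Submodule.mem_torsion_iff, Subtype.exists,
    mem_nonZeroDivisors_iff_ne_zero, exists_prop, Submonoid.mk_smul, h]

lemma le_pureClosure (N : Submodule ℤ H) : N ≤ pureClosure N :=
  fun y hy ↦ mem_pureClosure.2 ⟨1, one_ne_zero, by simpa⟩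

lemma pureClosure_mono {N N' : Submodule ℤ H} (h : N ≤ N') : pureClosure N ≤ pureClosure N' := by
  intro y hy
  obtain ⟨m, hm, hmy⟩ := mem_pureClosure.1 hy
  exact mem_pureClosure.2 ⟨m, hm, h hmy⟩

lemma mem_pureClosure_of_smul_mem {N : Submodule ℤ H} {m : ℤ} (hm : m ≠ 0) {y : H}
    (h : m • y ∈ pureClosure N) : y ∈ pureClosure N := by
  obtain ⟨m', hm', hy⟩ := mem_pureClosure.1 h
  exact mem_pureClosure.2 ⟨m' * m, mul_ne_zero hm' hm, by rwa [mul_smul]⟩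

lemma DetectsZero.isTorsionFree (hH : DetectsZero H) : Module.IsTorsionFree ℤ H := by
  refine Module.IsTorsionFree.of_smul_eq_zero fun m x hmx ↦ or_iff_not_imp_left.2 fun hm ↦ ?_
  refine congrFun (hH 1 (fun _ ↦ x) fun k hk ↦ ⟨0, fun _ ↦ m, ?_, 0, by simpa⟩) 0
  have : k 0 ≠ 0 := fun h ↦ hk (funext fun i ↦ by rw [Subsingleton.elim i 0, h]; rfl)
  simp [hm, this]

lemma DetectsZero.exists_hom (hH : DetectsZero H) {N : Submodule ℤ H} (hN : N.FG) (hne : N ≠ ⊥) :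
    ∃ h : H →ₗ[ℤ] ℚ, (∃ x ∈ N, h x ≠ 0) ∧ ∀ y ∈ pureClosure N, ∃ z : ℤ, h y = z := by
  obtain ⟨n, x, rfl⟩ := Submodule.fg_iff_exists_fin_generating_family.1 hN
  have hx : x ≠ 0 := by
    rintro rfl
    exact hne (by simp [Submodule.span_eq_bot])
  have := mt (hH n x) hx
  push Not at this
  obtain ⟨k, hk, hdiv⟩ := this
  let L := Fintype.linearCombination ℤ x
  let φ := Fintype.linearCombination ℤ fun i ↦ (k i : ℚ)
  have hL : ∀ l, L l = ∑ i, l i • x i := fun l ↦ Fintype.linearCombination_apply ..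
  have hφ : ∀ l, φ l = (∑ i, l i * k i : ℤ) := fun l ↦ by
    simp [φ, Fintype.linearCombination_apply]
  have hker : LinearMap.ker L ≤ LinearMap.ker φ := by
    intro l hl
    rw [LinearMap.mem_ker, hL] at hl
    have : (0 : ℤ) ∣ ∑ i, l i * k i := by
      by_contra h
      exact hdiv 0 l h 0 (by simpa)
    rw [LinearMap.mem_ker, hφ, zero_dvd_iff.1 this, Int.cast_zero]
  let g : LinearMap.range L →ₗ[ℤ] ℚ :=
    (LinearMap.ker L).liftQ φ hker ∘ₗ L.quotKerEquivRange.symm.toLinearMap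
  have hg : ∀ l, g ⟨L l, LinearMap.mem_range_self L l⟩ = φ l := by
    intro l
    simp only [g, LinearMap.comp_apply, LinearEquiv.coe_coe]
    rw [LinearMap.quotKerEquivRange_symm_apply_image, Submodule.mkQ_apply, Submodule.liftQ_apply]
  obtain ⟨h, hh⟩ := exists_extension_of_divisible (LinearMap.range L).toAddSubgroup
    g.toAddMonoidHom
  have hhL : ∀ l, h (L l) = (∑ i, l i * k i : ℤ) := fun l ↦ by
    rw [← hφ, ← hg]
    exact hh ⟨L l, LinearMap.mem_range_self L l⟩
  refine ⟨h.toIntLinearMap, ?_, fun y hy ↦ ?_⟩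
  · obtain ⟨i, hi⟩ := Function.ne_iff.1 hk
    refine ⟨x i, Submodule.subset_span ⟨i, rfl⟩, ?_⟩
    have := hhL (Pi.single i 1)
    rw [Fintype.linearCombination_apply_single, one_smul] at this
    simpa [this, Pi.single_apply] using hi
  · obtain ⟨m, hm, hmy⟩ := mem_pureClosure.1 hy
    rw [← Fintype.range_linearCombination] at hmy
    obtain ⟨l, hl⟩ := hmy
    have hdvd : m ∣ ∑ i, l i * k i := by
      by_contra hnd
      exact hdiv m l hnd y (by rw [← hL]; exact hl)
    obtain ⟨z, hz⟩ := hdvd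
    refine ⟨z, ?_⟩
    have := hhL l
    rw [show L l = m • y from hl, hz, map_zsmul, zsmul_eq_mul, Int.cast_mul] at this
    exact mul_left_cancel₀ (Int.cast_ne_zero.2 hm) this

lemma DetectsZero.fg_pureClosure (hH : DetectsZero H) {N : Submodule ℤ H} (hN : N.FG) :
    (pureClosure N).FG := by
  have := hH.isTorsionFree
  induction hr : Module.finrank ℤ N using Nat.strong_induction_on generalizing N with
  | h r ih =>
    subst hr
    by_cases hne : N = ⊥
    · subst hne
      convert Submodule.fg_bot (R := ℤ) (M := H)
      rw [eq_bot_iff]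
      intro y hy
      obtain ⟨m, hm, hmy⟩ := mem_pureClosure.1 hy
      exact (smul_eq_zero.1 ((Submodule.mem_bot ℤ).1 hmy)).resolve_left hm
    obtain ⟨h, ⟨x, hx, hxh⟩, hint⟩ := hH.exists_hom hN hne
    have := Module.Finite.iff_fg.2 hN
    have hN' : (N ⊓ LinearMap.ker h).FG := hN.of_le inf_le_left
    have hlt : Module.finrank ℤ ↥(N ⊓ LinearMap.ker h) < Module.finrank ℤ N := by
      have he : N ⊓ LinearMap.ker h = (LinearMap.ker (h.domRestrict N)).map N.subtype := by
        rw [LinearMap.domRestrict, LinearMap.ker_comp, Submodule.map_comap_subtype]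
      have hpos : 0 < Module.finrank ℤ (LinearMap.range (h.domRestrict N)) := by
        have : Nontrivial (LinearMap.range (h.domRestrict N)) :=
          ⟨⟨⟨_, ⟨x, hx⟩, rfl⟩, 0, fun h0 ↦ hxh (congrArg Subtype.val h0)⟩⟩
        exact Module.finrank_pos
      rw [he, LinearEquiv.finrank_eq (Submodule.equivSubtypeMap N _).symm,
        ← Submodule.finrank_quotient_add_finrank (LinearMap.ker (h.domRestrict N)),
        (h.domRestrict N).quotKerEquivRange.finrank_eq]
      exact Nat.lt_add_of_pos_left hpos
    refine Submodule.fg_of_fg_map_of_fg_inf_ker h ?_ ?_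
    · have : (LinearMap.range (Int.castAddHom ℚ).toIntLinearMap).FG :=
        Module.Finite.iff_fg.1 inferInstance
      refine Submodule.FG.of_le this ?_
      rintro _ ⟨y, hy, rfl⟩
      obtain ⟨z, hz⟩ := hint y hy
      exact ⟨z, hz.symm⟩
    · refine Submodule.FG.of_le (ih _ hlt hN' rfl) ?_
      rintro y ⟨hy, hy'⟩
      obtain ⟨m, hm, hmy⟩ := mem_pureClosure.1 hy
      refine mem_pureClosure.2 ⟨m, hm, hmy, ?_⟩
      have hy' : h y = 0 := hy'
      change h (m • y) = 0
      rw [map_zsmul, hy', smul_zero]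

lemma DetectsZero.free_of_countable [Countable H] (hH : DetectsZero H) : Module.Free ℤ H := by
  obtain ⟨d, hd⟩ := exists_surjective_nat H
  have := hH.isTorsionFree
  let U : ℕ → Submodule ℤ H := fun j ↦ pureClosure (Submodule.span ℤ (d '' Set.Iic j))
  have hU : Monotone U := fun i j hij ↦
    pureClosure_mono (Submodule.span_mono (Set.image_mono (Set.Iic_subset_Iic.2 hij)))
  refine free_of_filtration (U := U) (fun x ↦ ?_) fun j ↦ ?_
  · obtain ⟨j, rfl⟩ := hd x
    exact ⟨j, le_pureClosure _ (Submodule.subset_span ⟨j, Set.mem_Iic.2 le_rfl, rfl⟩)⟩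
  have hpure : ∀ (m : ℤ) (y : H), m ≠ 0 → m • y ∈ (⨆ k : Set.Iio j, U k) →
      y ∈ ⨆ k : Set.Iio j, U k := by
    intro m y hm hmy
    rcases isEmpty_or_nonempty (Set.Iio j) with hj | hj
    · rw [iSup_of_empty, Submodule.mem_bot] at hmy ⊢
      exact (smul_eq_zero.1 hmy).resolve_left hm
    · have hdir : Directed (· ≤ ·) fun k : Set.Iio j ↦ U k :=
        (hU.comp (Subtype.mono_coe _)).directed_le
      rw [Submodule.mem_iSup_of_directed _ hdir] at hmy
      obtain ⟨k, hk⟩ := hmy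
      exact Submodule.mem_iSup_of_mem k (mem_pureClosure_of_smul_mem hm hk)
  generalize (⨆ k : Set.Iio j, U k) = V at hpure
  have : Module.IsTorsionFree ℤ (H ⧸ V) := by
    refine Module.IsTorsionFree.of_smul_eq_zero fun m z hmz ↦ or_iff_not_imp_left.2 fun hm ↦ ?_
    induction z using Submodule.Quotient.induction_on with
    | _ y =>
      rw [← Submodule.Quotient.mk_smul, Submodule.Quotient.mk_eq_zero] at hmz
      exact (Submodule.Quotient.mk_eq_zero V).2 (hpure m y hm hmz)
  have : (U j).FG := hH.fg_pureClosure (Submodule.fg_span ((Set.finite_Iic j).image d))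
  have : Module.Finite ℤ ((U j).map V.mkQ) := Module.Finite.iff_fg.2 (this.map _)
  exact Module.free_of_finite_type_torsion_free'

/-- Tuples over `A` all of whose nonzero integer values are excluded lie in `A`. -/
def NoExcludedTuples (A : AddSubgroup H) : Prop :=
  ∀ (n : ℕ) (x : Fin n → H), ExcludesAll A x → ∀ i, x i ∈ A

lemma NoExcludedTuples.free_map {A : AddSubgroup H} (hA : NoExcludedTuples A)
    {U : Submodule ℤ H} (hU : (U : Set H).Countable) :
    Module.Free ℤ (U.map (AddSubgroup.toIntSubmodule A).mkQ) := by
  set V := AddSubgroup.toIntSubmodule A with hV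
  have : Countable (U.map V.mkQ) := by
    have := hU.image V.mkQ
    exact this.to_subtype
  refine DetectsZero.free_of_countable fun n z hz ↦ ?_
  choose x hxU hx using fun i ↦ (z i).2
  have hxA : ∀ i, x i ∈ A := hA n x fun k hk ↦ by
    obtain ⟨m, l, hml, y, hy⟩ := hz k hk
    obtain ⟨w, hwU, hw⟩ := y.2
    refine ⟨(m, l, ∑ i, l i • x i - m • w), ?_, hml, w, by simp⟩
    change _ ∈ V
    refine (Submodule.Quotient.mk_eq_zero V).1 ?_
    have hy' := congrArg Subtype.val hy
    rw [← Submodule.mkQ_apply]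
    simp only [map_sub, map_sum, map_zsmul, hx, hw]
    rw [sub_eq_zero]
    simpa using hy'
  funext i
  refine Subtype.ext ?_
  rw [← hx i]
  exact (Submodule.Quotient.mk_eq_zero V).2 (hxA i)

end Pontryagin

section Stationary

variable {B : Type*} [AddCommGroup B]

/-- `A` is closed under the set-valued finitary operation `F`. -/
def IsClosedUnder (F : List B → Set B) (A : AddSubgroup B) : Prop :=
  ∀ l : List B, (∀ b ∈ l, b ∈ A) → F l ⊆ A

/-- A family of subgroups of `B` is nonstationary (in `[B]^ω`) if it avoids the closed unbounded
family of subgroups closed under some countably-valued operation. -/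
def IsNonstationary (𝒮 : Set (AddSubgroup B)) : Prop :=
  ∃ F : List B → Set B, (∀ l, (F l).Countable) ∧ ∀ A ∈ 𝒮, ¬IsClosedUnder F A

namespace IsNonstationary

lemma mono {𝒮 𝒯 : Set (AddSubgroup B)} (h : IsNonstationary 𝒯) (hst : 𝒮 ⊆ 𝒯) :
    IsNonstationary 𝒮 := by
  obtain ⟨F, hF, h⟩ := h
  exact ⟨F, hF, fun A hA ↦ h A (hst hA)⟩

lemma iUnion {ι : Type*} [Countable ι] {𝒮 : ι → Set (AddSubgroup B)}
    (h : ∀ i, IsNonstationary (𝒮 i)) : IsNonstationary (⋃ i, 𝒮 i) := by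
  choose F hF h using h
  refine ⟨fun l ↦ ⋃ i, F i l, fun l ↦ Set.countable_iUnion fun i ↦ hF i l, fun A hA hcl ↦ ?_⟩
  obtain ⟨i, hi⟩ := Set.mem_iUnion.1 hA
  exact h i A hi fun l hl ↦ (Set.subset_iUnion (fun i ↦ F i l) i).trans (hcl l hl)

/-- Normality of the nonstationary ideal (Fodor's lemma). -/
lemma of_regressive {𝒮 : Set (AddSubgroup B)} (g : AddSubgroup B → B) (hg : ∀ A ∈ 𝒮, g A ∈ A)
    (h : ∀ b, IsNonstationary {A ∈ 𝒮 | g A = b}) : IsNonstationary 𝒮 := by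
  choose F hF h using h
  refine ⟨fun l ↦ l.casesOn ∅ fun b l ↦ F b l, fun l ↦ ?_, fun A hA hcl ↦ ?_⟩
  · cases l with
    | nil => exact Set.countable_empty
    | cons b l => exact hF b l
  · refine h (g A) A ⟨hA, rfl⟩ fun l hl ↦ hcl (g A :: l) ?_
    simpa using ⟨hg A hA, hl⟩

lemma of_mem {𝒮 : Set (AddSubgroup B)} {C : Set B} (hC : C.Countable)
    (h : IsNonstationary {A ∈ 𝒮 | C ⊆ A}) : IsNonstationary 𝒮 := by
  obtain ⟨F, hF, h⟩ := h
  refine ⟨fun l ↦ F l ∪ C, fun l ↦ (hF l).union hC, fun A hA hcl ↦ ?_⟩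
  refine h A ⟨hA, ?_⟩ fun l hl ↦ Set.subset_union_left.trans (hcl l hl)
  exact Set.subset_union_right.trans (hcl [] (by simp))

lemma empty : IsNonstationary (∅ : Set (AddSubgroup B)) :=
  ⟨fun _ ↦ ∅, by simp, by simp⟩

end IsNonstationary

lemma exists_forall_mem_list_of_directed {ι : Type*} [Nonempty ι] {A : ι → AddSubgroup B}
    (hdir : Directed (· ≤ ·) A) {l : List B} (hl : ∀ b ∈ l, b ∈ ⨆ i, A i) :
    ∃ i, ∀ b ∈ l, b ∈ A i := by
  induction l with
  | nil => simp
  | cons b l ih =>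
    simp only [List.mem_cons, forall_eq_or_imp] at hl ⊢
    obtain ⟨i, hi⟩ := (AddSubgroup.mem_iSup_of_directed hdir).1 hl.1
    obtain ⟨j, hj⟩ := ih hl.2
    obtain ⟨k, hik, hjk⟩ := hdir i j
    exact ⟨k, hik hi, fun b hb ↦ hjk (hj b hb)⟩

lemma IsClosedUnder.iSup_of_directed {ι : Type*} [Nonempty ι] {F : List B → Set B}
    {A : ι → AddSubgroup B} (hdir : Directed (· ≤ ·) A) (h : ∀ i, IsClosedUnder F (A i)) :
    IsClosedUnder F (⨆ i, A i) := by
  intro l hl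
  obtain ⟨i, hi⟩ := exists_forall_mem_list_of_directed hdir hl
  exact (h i l hi).trans (SetLike.coe_subset_coe.2 (le_iSup A i))

lemma exists_countable_isClosedUnder {F : List B → Set B} (hF : ∀ l, (F l).Countable)
    {s : Set B} (hs : s.Countable) :
    ∃ A : AddSubgroup B, (A : Set B).Countable ∧ s ⊆ A ∧ IsClosedUnder F A := by
  let step (A : AddSubgroup B) : AddSubgroup B :=
    A ⊔ AddSubgroup.closure (⋃ l : List A, F (l.map (↑)))
  let A : ℕ → AddSubgroup B := fun n ↦ step^[n] (AddSubgroup.closure s)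
  have hsucc : ∀ n, A (n + 1) = step (A n) := fun n ↦ Function.iterate_succ_apply' _ _ _
  have hmono : Monotone A := monotone_nat_of_le_succ fun n ↦ by
    rw [hsucc]
    exact le_sup_left
  have hc : ∀ n, (A n : Set B).Countable := by
    intro n
    induction n with
    | zero => exact hs.addSubgroup_closure
    | succ n ih =>
      rw [hsucc]
      have := ih.to_subtype
      exact AddSubgroup.countable_sup ih
        (Set.countable_iUnion fun l ↦ hF _).addSubgroup_closure
  refine ⟨⨆ n, A n, AddSubgroup.countable_iSup hc,
    AddSubgroup.subset_closure.trans (SetLike.coe_subset_coe.2 (le_iSup A 0)), fun l hl ↦ ?_⟩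
  obtain ⟨n, hn⟩ := exists_forall_mem_list_of_directed hmono.directed_le hl
  lift l to List (A n) using hn
  refine subset_trans ?_ (SetLike.coe_subset_coe.2 (le_iSup A (n + 1)))
  rw [hsucc]
  refine (Set.subset_iUnion (fun l : List (A n) ↦ F (l.map (↑))) l).trans ?_
  exact AddSubgroup.subset_closure.trans (SetLike.coe_subset_coe.2 le_sup_right)

/-- The countable subgroups over which some tuple outside is excluded. -/
def badSubgroups (B : Type*) [AddCommGroup B] : Set (AddSubgroup B) :=
  {A | (A : Set B).Countable ∧ ¬NoExcludedTuples A}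

theorem free_of_isNonstationary_badSubgroups (hcard : #B ≤ ℵ₁) (hl : LiftsCharacters B)
    (h : IsNonstationary (badSubgroups B)) : Module.Free ℤ B := by
  obtain ⟨F, hF, hbad⟩ := h
  obtain ⟨_, _, hJ⟩ := exists_wellOrder_countable_Iio hcard
  let U : B → AddSubgroup B := fun b ↦
    sInf {A | Set.Iic b ⊆ A ∧ IsClosedUnder F A}
  have hUmem : ∀ b, Set.Iic b ⊆ (U b : Set B) := fun b x hx ↦ by
    refine AddSubgroup.mem_sInf.2 fun A hA ↦ hA.1 hx
  have hUcl : ∀ b, IsClosedUnder F (U b) := fun b l hl x hx ↦ by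
    refine AddSubgroup.mem_sInf.2 fun A hA ↦
      hA.2 l (fun y hy ↦ AddSubgroup.mem_sInf.1 (hl y hy) A hA) hx
  have hUmono : Monotone U := fun a b hab ↦
    sInf_le_sInf fun A hA ↦ ⟨(Set.Iic_subset_Iic.2 hab).trans hA.1, hA.2⟩
  have hUc : ∀ b, (U b : Set B).Countable := by
    intro b
    have hb : (Set.Iic b).Countable := by
      rw [← Set.Iio_insert]
      exact (hJ b).insert b
    obtain ⟨A, hA, hbA, hcl⟩ := exists_countable_isClosedUnder hF hb
    exact hA.mono (SetLike.coe_subset_coe.2 (sInf_le ⟨hbA, hcl⟩))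
  refine free_of_filtration (U := fun b ↦ AddSubgroup.toIntSubmodule (U b))
    (fun x ↦ ⟨x, hUmem x (Set.mem_Iic.2 le_rfl)⟩) fun b ↦ ?_
  rw [← OrderIso.map_iSup]
  refine NoExcludedTuples.free_map ?_ (hUc b)
  rcases isEmpty_or_nonempty (Set.Iio b) with hb | hb
  · rw [iSup_of_empty]
    intro n x hx i
    simp [hx.eq_zero hl]
  · by_contra hn
    have := (hJ b).to_subtype
    exact hbad _ ⟨AddSubgroup.countable_iSup fun k : Set.Iio b ↦ hUc k, hn⟩
      (IsClosedUnder.iSup_of_directed (hUmono.comp (Subtype.mono_coe _)).directed_le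
        fun k ↦ hUcl k)

end Stationary

section Splitting

variable {B : Type*} [AddCommGroup B]

lemma IsNonstationary.of_regressive_prod {D : Type*} [Countable D] {𝒮 : Set (AddSubgroup B)}
    (d : AddSubgroup B → D) (g : AddSubgroup B → B) (hg : ∀ A ∈ 𝒮, g A ∈ A)
    (h : ∀ c b, IsNonstationary {A ∈ 𝒮 | d A = c ∧ g A = b}) : IsNonstationary 𝒮 := by
  refine (IsNonstationary.iUnion (𝒮 := fun c ↦ {A ∈ 𝒮 | d A = c}) fun c ↦ ?_).mono
    fun A hA ↦ Set.mem_iUnion.2 ⟨d A, hA, rfl⟩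
  exact .of_regressive g (fun A hA ↦ hg A hA.1) fun b ↦
    (h c b).mono fun A hA ↦ ⟨hA.1.1, hA.1.2, hA.2⟩

/-- Finitely many regressive functions are simultaneously constant on a stationary set. -/
lemma exists_stationary_agree {D : Type*} [Countable D] {𝒮 : Set (AddSubgroup B)}
    (h𝒮 : ¬IsNonstationary 𝒮) (d : AddSubgroup B → ℕ → D) (g : AddSubgroup B → ℕ → B)
    (hg : ∀ A ∈ 𝒮, ∀ j, g A j ∈ A) (N : ℕ) :
    ∃ A₀ ∈ 𝒮, ¬IsNonstationary {A ∈ 𝒮 | ∀ i < N, d A i = d A₀ i ∧ g A i = g A₀ i} := by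
  induction N with
  | zero =>
    have : 𝒮.Nonempty := by
      rw [Set.nonempty_iff_ne_empty]
      rintro rfl
      exact h𝒮 .empty
    obtain ⟨A₀, hA₀⟩ := this
    exact ⟨A₀, hA₀, by simpa using h𝒮⟩
  | succ N ih =>
    obtain ⟨A₀, hA₀, hst⟩ := ih
    have := mt (IsNonstationary.of_regressive_prod (d · N) (g · N) fun A hA ↦ hg A hA.1 N) hst
    push Not at this
    obtain ⟨c, b, hcb⟩ := this
    obtain ⟨A₁, hA₁⟩ : {A ∈ {A ∈ 𝒮 | ∀ i < N, d A i = d A₀ i ∧ g A i = g A₀ i} |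
        d A N = c ∧ g A N = b}.Nonempty := by
      rw [Set.nonempty_iff_ne_empty]
      intro h
      exact hcb (h ▸ .empty)
    refine ⟨A₁, hA₁.1.1, fun hns ↦ hcb (hns.mono fun A hA ↦ ⟨hA.1.1, fun i hi ↦ ?_⟩)⟩
    rcases Nat.lt_succ_iff_lt_or_eq.1 hi with hi | rfl
    · rw [(hA.1.2 i hi).1, (hA.1.2 i hi).2, (hA₁.1.2 i hi).1, (hA₁.1.2 i hi).2]
      exact ⟨rfl, rfl⟩
    · rw [hA.2.1, hA.2.2, hA₁.2.1, hA₁.2.2]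
      exact ⟨rfl, rfl⟩

/-- Every set of relations has a countable subset with the same solutions. -/
lemma exists_countable_subset_sat {n : ℕ} (T : Set (ℤ × (Fin n → ℤ) × B)) :
    ∃ T₀ ⊆ T, T₀.Countable ∧ ∀ r : Fin n → B, (∀ t ∈ T₀, Sat r t) → ∀ t ∈ T, Sat r t := by
  have key : ∀ c : ℤ × (Fin n → ℤ), ∃ T₀ ⊆ T, T₀.Countable ∧ ∀ r : Fin n → B,
      (∀ t ∈ T₀, Sat r t) → ∀ b, (c.1, c.2, b) ∈ T → Sat r (c.1, c.2, b) := by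
    rintro ⟨m, l⟩
    by_cases hne : ∃ b₀, (m, l, b₀) ∈ T
    · obtain ⟨b₀, hb₀⟩ := hne
      by_cases hinc : ∃ b₁, (m, l, b₁) ∈ T ∧ ∀ z, b₀ - b₁ ≠ m • z
      · obtain ⟨b₁, hb₁, hz⟩ := hinc
        refine ⟨{(m, l, b₀), (m, l, b₁)}, by simp [Set.insert_subset_iff, hb₀, hb₁],
          Set.Countable.insert _ (Set.countable_singleton _), fun r hr ↦ ?_⟩
        obtain ⟨y₀, h₀⟩ := hr (m, l, b₀) (by simp)
        obtain ⟨y₁, h₁⟩ := hr (m, l, b₁) (by simp)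
        refine absurd ?_ (hz (y₁ - y₀))
        simp only [h₀] at h₁
        rw [smul_sub, sub_eq_sub_iff_add_eq_add, add_comm, h₁]
      · push Not at hinc
        refine ⟨{(m, l, b₀)}, by simpa, Set.countable_singleton _, fun r hr b hb ↦ ?_⟩
        obtain ⟨y, hy⟩ := hr (m, l, b₀) rfl
        obtain ⟨z, hz⟩ := hinc b hb
        refine ⟨y + z, ?_⟩
        simp only at hy ⊢
        rw [hy, smul_add, ← hz]
        abel
    · exact ⟨∅, by simp, Set.countable_empty, fun r _ b hb ↦ (hne ⟨b, hb⟩).elim⟩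
  choose T₀ hT₀ hc hs using key
  refine ⟨⋃ c, T₀ c, Set.iUnion_subset hT₀, Set.countable_iUnion hc, fun r hr t ht ↦ ?_⟩
  exact hs (t.1, t.2.1) r (fun t ht ↦ hr t (Set.mem_iUnion.2 ⟨_, ht⟩)) t.2.2 ht

/-- A family of subgroups `A` with bad tuples `x A`, relations `τ A j` witnessing this,
and auxiliary integers `v A j`. -/
structure BadFamily (B : Type*) [AddCommGroup B] (n : ℕ) where
  carrier : Set (AddSubgroup B)
  x : AddSubgroup B → Fin n → B
  k : ℕ → Fin n → ℤ
  τ : AddSubgroup B → ℕ → ℤ × (Fin n → ℤ) × B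
  v : AddSubgroup B → ℕ → ℕ
  k_surjective : Function.Surjective k
  exists_notMem : ∀ A ∈ carrier, ∃ i, x A i ∉ A
  mem : ∀ A ∈ carrier, ∀ j, (τ A j).2.2 ∈ A
  sat : ∀ A ∈ carrier, ∀ j, Sat (x A) (τ A j)
  not_dvd : ∀ A ∈ carrier, ∀ j, k j ≠ 0 → ¬(τ A j).1 ∣ ∑ i, (τ A j).2.1 i * k j i

namespace BadFamily

variable {n : ℕ} (S : BadFamily B n)

/-- `A` and `A'` have the same data up to `N`. -/
def Agree (N : ℕ) (A A' : AddSubgroup B) : Prop :=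
  ∀ i < N, S.τ A i = S.τ A' i ∧ S.v A i = S.v A' i

/-- The members of the family whose data have the given initial segment. -/
def cone (p : AddSubgroup B × ℕ) : Set (AddSubgroup B) :=
  {A ∈ S.carrier | S.Agree p.2 A p.1}

/-- The values taken by `τ` stationarily often in a cone are not satisfied by any single tuple. -/
lemma exists_not_sat (hl : LiftsCharacters B) {p : AddSubgroup B × ℕ}
    (hp : ¬IsNonstationary (S.cone p)) (r : Fin n → B) :
    ∃ t ∈ {t | ∃ j, ¬IsNonstationary {A ∈ S.cone p | S.τ A j = t}}, ¬Sat r t := by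
  by_contra! hr
  have h₁ : IsNonstationary (⋃ j, {A ∈ S.cone p | IsNonstationary
      {A' ∈ S.cone p | S.τ A' j = S.τ A j}}) := by
    refine .iUnion fun j ↦ ?_
    refine .of_regressive_prod (fun A ↦ ((S.τ A j).1, (S.τ A j).2.1)) (fun A ↦ (S.τ A j).2.2)
      (fun A hA ↦ S.mem A hA.1.1 j) fun c b ↦ ?_
    rcases Set.eq_empty_or_nonempty {A ∈ {A ∈ S.cone p | IsNonstationary
      {A' ∈ S.cone p | S.τ A' j = S.τ A j}} |
        ((S.τ A j).1, (S.τ A j).2.1) = c ∧ (S.τ A j).2.2 = b} with he | ⟨A, hA, rfl, rfl⟩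
    · exact he ▸ .empty
    · refine hA.2.mono fun A' hA' ↦ ⟨hA'.1.1, ?_⟩
      obtain ⟨-, h, h'⟩ := hA'
      rw [Prod.mk.injEq] at h
      exact Prod.ext h.1 (Prod.ext h.2 h')
  refine hp (.of_mem (Set.countable_range r) (h₁.mono fun A hA ↦ ?_))
  by_contra hA'
  simp only [Set.mem_iUnion, Set.mem_ofPred_eq, not_exists, not_and] at hA'
  obtain ⟨i, hi⟩ := S.exists_notMem A hA.1.1
  have hxr : S.x A = r := by
    refine eq_of_forall_sat hl fun k hk ↦ ?_
    obtain ⟨j, rfl⟩ := S.k_surjective k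
    exact ⟨S.τ A j, S.not_dvd A hA.1.1 j hk, S.sat A hA.1.1 j, hr _ ⟨j, hA' j hA.1⟩⟩
  exact hi (hxr ▸ hA.2 ⟨i, rfl⟩)

lemma exists_extensions (hl : LiftsCharacters B) {p : AddSubgroup B × ℕ}
    (hp : ¬IsNonstationary (S.cone p)) :
    ∃ E : Set (AddSubgroup B × ℕ), E.Countable ∧
      (∀ p' ∈ E, p.2 < p'.2 ∧ S.Agree p.2 p'.1 p.1 ∧ ¬IsNonstationary (S.cone p')) ∧
      ∀ r, ∃ p' ∈ E, ∃ j < p'.2, ¬Sat r (S.τ p'.1 j) := by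
  obtain ⟨T₀, hT₀, hc, hs⟩ := exists_countable_subset_sat
    {t | ∃ j, ¬IsNonstationary {A ∈ S.cone p | S.τ A j = t}}
  have : ∀ t, ∃ p' : AddSubgroup B × ℕ, t ∈ T₀ → p.2 < p'.2 ∧ S.Agree p.2 p'.1 p.1 ∧
      ¬IsNonstationary (S.cone p') ∧ ∃ j < p'.2, S.τ p'.1 j = t := by
    intro t
    by_cases ht : t ∈ T₀
    · obtain ⟨j, hj⟩ := hT₀ ht
      obtain ⟨A₀, hA₀, hst⟩ := exists_stationary_agree hj
        (fun A i ↦ ((S.τ A i).1, (S.τ A i).2.1, S.v A i)) (fun A i ↦ (S.τ A i).2.2)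
        (fun A hA i ↦ S.mem A hA.1.1 i) (max p.2 j + 1)
      refine ⟨(A₀, max p.2 j + 1), fun _ ↦ ⟨by grind, hA₀.1.2,
        fun h ↦ hst (h.mono fun A hA ↦ ⟨hA.1.1.1, fun i hi ↦ ?_⟩), j, by grind, hA₀.2⟩⟩
      obtain ⟨h₁, h₂⟩ := hA.2 i hi
      simp only [Prod.mk.injEq] at h₁
      exact ⟨Prod.ext h₁.1 (Prod.ext h₁.2.1 h₂), h₁.2.2⟩
    · exact ⟨p, fun h ↦ (ht h).elim⟩
  choose e he using this
  refine ⟨e '' T₀, hc.image e, ?_, fun r ↦ ?_⟩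
  · rintro _ ⟨t, ht, rfl⟩
    exact ⟨(he t ht).1, (he t ht).2.1, (he t ht).2.2.1⟩
  · obtain ⟨t, ht, hrt⟩ := S.exists_not_sat hl hp r
    obtain ⟨t₀, ht₀, hrt₀⟩ : ∃ t₀ ∈ T₀, ¬Sat r t₀ := by
      by_contra! h
      exact hrt (hs r h t ht)
    obtain ⟨j, hj, hjt⟩ := (he t₀ ht₀).2.2.2
    exact ⟨_, ⟨_, ht₀, rfl⟩, j, hj, hjt.symm ▸ hrt₀⟩

/-- If the relations along every branch of the tree of initial segments are simultaneously
satisfiable, then the family is nonstationary. -/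
theorem isNonstationary_carrier (hl : LiftsCharacters B)
    (hR : ∀ A : AddSubgroup B, (A : Set B).Countable → (intRadical A).Countable)
    (hlim : ∀ (τ : ℕ → ℤ × (Fin n → ℤ) × B) (v : ℕ → ℕ),
      (∀ N, ∃ A ∈ S.carrier, ∀ i < N, S.τ A i = τ i ∧ S.v A i = v i) →
        ∃ x : Fin n → B, ∀ j, Sat x (τ j)) :
    IsNonstationary S.carrier := by
  by_contra hst
  have hE : ∀ p, ∃ E : Set (AddSubgroup B × ℕ), E.Countable ∧ (¬IsNonstationary (S.cone p) →
      (∀ p' ∈ E, p.2 < p'.2 ∧ S.Agree p.2 p'.1 p.1 ∧ ¬IsNonstationary (S.cone p')) ∧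
      ∀ r, ∃ p' ∈ E, ∃ j < p'.2, ¬Sat r (S.τ p'.1 j)) := by
    intro p
    by_cases hp : IsNonstationary (S.cone p)
    · exact ⟨∅, Set.countable_empty, fun h ↦ (h hp).elim⟩
    · obtain ⟨E, hc, hE⟩ := S.exists_extensions hl hp
      exact ⟨E, hc, fun _ ↦ hE⟩
  choose E hEc hE using hE
  let P : ℕ → Set (AddSubgroup B × ℕ) := fun m ↦ (fun Q ↦ ⋃ p ∈ Q, E p)^[m] {(⊥, 0)}
  have hPsucc : ∀ m, P (m + 1) = ⋃ p ∈ P m, E p := fun m ↦ Function.iterate_succ_apply' _ _ _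
  have hPc : ∀ m, (P m).Countable := by
    intro m
    induction m with
    | zero => exact Set.countable_singleton _
    | succ m ih =>
      rw [hPsucc]
      exact ih.biUnion fun p _ ↦ hEc p
  let A' := AddSubgroup.closure (⋃ j, (fun p ↦ (S.τ p.1 j).2.2) '' ⋃ m, P m)
  have hA' : (A' : Set B).Countable := Set.Countable.addSubgroup_closure
    (Set.countable_iUnion fun j ↦ (Set.countable_iUnion hPc).image _)
  obtain ⟨r, hr⟩ := Set.countable_iff_exists_subset_range.1
    (Set.countable_pi (α := Fin n) fun _ ↦ hR A' hA')
  have hnext : ∀ j p, ∃ p' : AddSubgroup B × ℕ, ¬IsNonstationary (S.cone p) → p' ∈ E p ∧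
      p.2 < p'.2 ∧ S.Agree p.2 p'.1 p.1 ∧ ¬IsNonstationary (S.cone p') ∧
      ∃ i < p'.2, ¬Sat (r j) (S.τ p'.1 i) := by
    intro j p
    by_cases hp : IsNonstationary (S.cone p)
    · exact ⟨p, fun h ↦ (h hp).elim⟩
    · obtain ⟨h₁, h₂⟩ := hE p hp
      obtain ⟨p', hp', hi⟩ := h₂ (r j)
      exact ⟨p', fun _ ↦ ⟨hp', (h₁ p' hp').1, (h₁ p' hp').2.1, (h₁ p' hp').2.2, hi⟩⟩
  choose next hnext using hnext
  let p : ℕ → AddSubgroup B × ℕ := fun j ↦ Nat.rec (⊥, 0) next j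
  have hst' : ∀ j, ¬IsNonstationary (S.cone (p j)) := by
    intro j
    induction j with
    | zero => exact fun h ↦ hst (h.mono fun A hA ↦ ⟨hA, fun i hi ↦ (Nat.not_lt_zero i hi).elim⟩)
    | succ j ih => exact (hnext j (p j) ih).2.2.2.1
  have hp : ∀ j, p (j + 1) ∈ E (p j) ∧ (p j).2 < (p (j + 1)).2 ∧
      S.Agree (p j).2 (p (j + 1)).1 (p j).1 ∧
      ∃ i < (p (j + 1)).2, ¬Sat (r j) (S.τ (p (j + 1)).1 i) := fun j ↦ by
    obtain ⟨h₁, h₂, h₃, -, h₄⟩ := hnext j (p j) (hst' j)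
    exact ⟨h₁, h₂, h₃, h₄⟩
  have hmem : ∀ j, p j ∈ ⋃ m, P m := by
    refine fun j ↦ Set.mem_iUnion.2 ⟨j, ?_⟩
    induction j with
    | zero => exact rfl
    | succ j ih =>
      rw [hPsucc]
      exact Set.mem_biUnion ih (hp j).1
  have hlen : StrictMono fun j ↦ (p j).2 := strictMono_nat_of_lt_succ fun j ↦ (hp j).2.1
  have hagree : ∀ j j', j ≤ j' → S.Agree (p j).2 (p j').1 (p j).1 := by
    intro j j' hj
    induction j', hj using Nat.le_induction with
    | base => exact fun i _ ↦ ⟨rfl, rfl⟩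
    | succ j' hj ih =>
      intro i hi
      have h := (hp j').2.2.1 i (hi.trans_le (hlen.monotone hj))
      exact ⟨h.1.trans (ih i hi).1, h.2.trans (ih i hi).2⟩
  let τ' : ℕ → ℤ × (Fin n → ℤ) × B := fun i ↦ S.τ (p (i + 1)).1 i
  let v' : ℕ → ℕ := fun i ↦ S.v (p (i + 1)).1 i
  have hτ' : ∀ j, ∀ i < (p j).2, S.τ (p j).1 i = τ' i ∧ S.v (p j).1 i = v' i := by
    intro j i hi
    have h₁ := hagree j (max j (i + 1)) (le_max_left _ _) i hi
    have h₂ := hagree (i + 1) (max j (i + 1)) (le_max_right _ _) i (hlen.le_apply (x := i + 1))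
    exact ⟨h₁.1.symm.trans h₂.1, h₁.2.symm.trans h₂.2⟩
  have happrox : ∀ N, ∃ A ∈ S.carrier, ∀ i < N, S.τ A i = τ' i ∧ S.v A i = v' i := by
    intro N
    obtain ⟨A, hA⟩ : (S.cone (p N)).Nonempty := by
      rw [Set.nonempty_iff_ne_empty]
      intro h
      exact hst' N (h ▸ .empty)
    refine ⟨A, hA.1, fun i hi ↦ ?_⟩
    have hi' : i < (p N).2 := hi.trans_le (hlen.le_apply (x := N))
    exact ⟨(hA.2 i hi').1.trans (hτ' N i hi').1, (hA.2 i hi').2.trans (hτ' N i hi').2⟩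
  obtain ⟨x, hx⟩ := hlim τ' v' happrox
  have hexcl : ExcludesAll A' x := by
    intro k hk
    obtain ⟨j, rfl⟩ := S.k_surjective k
    obtain ⟨A, hA, hAj⟩ := happrox (j + 1)
    refine ⟨τ' j, AddSubgroup.subset_closure (Set.mem_iUnion.2 ⟨j, _, hmem (j + 1), rfl⟩), ?_, hx j⟩
    rw [← (hAj j (Nat.lt_succ_self j)).1]
    exact S.not_dvd A hA j hk
  obtain ⟨j, rfl⟩ := hr fun i ↦ hexcl.mem_intRadical hA' i
  obtain ⟨i, hi, hnot⟩ := (hp j).2.2.2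
  rw [(hτ' (j + 1) i hi).1] at hnot
  exact hnot (hx i)

end BadFamily

end Splitting

section Analytic

instance : PolishSpace Cantor := by
  have : TopologicalSpace.IsCompletelyMetrizableSpace Cantor := inferInstance
  infer_instance

lemma MeasureTheory.AnalyticSet.inter {X : Type*} [TopologicalSpace X] [T2Space X] {s t : Set X}
    (hs : AnalyticSet s) (ht : AnalyticSet t) : AnalyticSet (s ∩ t) := by
  rw [Set.inter_eq_iInter]
  exact AnalyticSet.iInter (by rintro (_ | _) <;> simpa)

variable {B : Type*} [AddCommGroup B] (c : SouslinCode B)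
  {X : Type*} [TopologicalSpace X] [PolishSpace X]

/-- The graph of `t` on `D`, expressed through codes, is analytic. -/
def SouslinCode.HasAnalyticGraph (D : Set X) (t : X → B) : Prop :=
  AnalyticSet {p : X × Cantor | p.1 ∈ D ∧ p.2 ∈ c.Bstar ∧ t p.1 = c.q p.2}

namespace SouslinCode

variable {c} {D : Set X}

lemma HasAnalyticGraph.comp_q (hD : AnalyticSet D) {π : X → Cantor} (hπ : Continuous π)
    (hDπ : ∀ x ∈ D, π x ∈ c.Bstar) : c.HasAnalyticGraph D fun x ↦ c.q (π x) := by
  have h := (AnalyticSet.inter (hD.preimage (continuous_fst (Y := Cantor)))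
    (c.analytic_Bstar.preimage (continuous_snd (X := X)))).inter
    (c.analytic_E.preimage ((hπ.comp continuous_fst).prodMk (continuous_snd (X := X))))
  refine (congrArg AnalyticSet ?_).mp h
  ext p
  constructor
  · rintro ⟨⟨h₁, h₂⟩, h₃⟩
    exact ⟨h₁, h₂, (c.q_eq_iff _ (hDπ _ h₁) _ h₂).2 h₃⟩
  · rintro ⟨h₁, h₂, h₃⟩
    exact ⟨⟨h₁, h₂⟩, (c.q_eq_iff _ (hDπ _ h₁) _ h₂).1 h₃⟩

lemma HasAnalyticGraph.const (hD : AnalyticSet D) (b : B) :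
    c.HasAnalyticGraph D fun _ ↦ b := by
  obtain ⟨z, hz, rfl⟩ := c.surj b
  exact .comp_q hD continuous_const fun _ _ ↦ hz

lemma HasAnalyticGraph.add {t s : X → B} (ht : c.HasAnalyticGraph D t)
    (hs : c.HasAnalyticGraph D s) : c.HasAnalyticGraph D fun x ↦ t x + s x := by
  have h₁ := ht.preimage (f := fun p : X × Cantor × Cantor × Cantor ↦ (p.1, p.2.1)) (by fun_prop)
  have h₂ := hs.preimage (f := fun p : X × Cantor × Cantor × Cantor ↦ (p.1, p.2.2.1))
    (by fun_prop)
  have h₃ := c.analytic_add.preimage (continuous_snd (X := X))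
  have h := ((h₁.inter h₂).inter h₃).image_of_continuous
    (f := fun p : X × Cantor × Cantor × Cantor ↦ (p.1, p.2.2.2)) (by fun_prop)
  refine (congrArg AnalyticSet ?_).mp h
  ext p
  constructor
  · rintro ⟨⟨x, u, v, z⟩, ⟨⟨⟨hx, -, hu⟩, -, -, hv⟩, -, -, hz, hadd⟩, rfl⟩
    exact ⟨hx, hz, by simp_all⟩
  · rintro ⟨hx, hz, hadd⟩
    obtain ⟨u, hu, hut⟩ := c.surj (t p.1)
    obtain ⟨v, hv, hvs⟩ := c.surj (s p.1)
    refine ⟨(p.1, u, v, p.2), ⟨⟨⟨hx, hu, hut.symm⟩, hx, hv, hvs.symm⟩, hu, hv, hz, ?_⟩, rfl⟩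
    rw [hut, hvs]
    exact hadd

lemma HasAnalyticGraph.neg {t : X → B} (ht : c.HasAnalyticGraph D t) :
    c.HasAnalyticGraph D fun x ↦ -t x := by
  obtain ⟨o, ho, ho0⟩ := c.surj 0
  have h₁ := ht.preimage (f := fun p : X × Cantor × Cantor ↦ (p.1, p.2.1)) (by fun_prop)
  have h₂ := c.analytic_add.preimage
    (f := fun p : X × Cantor × Cantor ↦ (p.2.1, p.2.2, o)) (by fun_prop)
  have h := (h₁.inter h₂).image_of_continuous
    (f := fun p : X × Cantor × Cantor ↦ (p.1, p.2.2)) (by fun_prop)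
  refine (congrArg AnalyticSet ?_).mp h
  ext p
  constructor
  · rintro ⟨⟨x, u, z⟩, ⟨⟨hx, -, hu⟩, -, hz, -, hadd⟩, rfl⟩
    refine ⟨hx, hz, ?_⟩
    simp only [ho0] at hu hadd ⊢
    rw [hu]
    exact neg_eq_of_add_eq_zero_right hadd
  · rintro ⟨hx, hz, hadd⟩
    obtain ⟨u, hu, hut⟩ := c.surj (t p.1)
    refine ⟨(p.1, u, p.2), ⟨⟨hx, hu, hut.symm⟩, hu, hz, ho, ?_⟩, rfl⟩
    simp only [hut, ho0, ← hadd]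
    exact add_neg_cancel _

lemma HasAnalyticGraph.zsmul (hD : AnalyticSet D) {t : X → B} (ht : c.HasAnalyticGraph D t)
    (m : ℤ) : c.HasAnalyticGraph D fun x ↦ m • t x := by
  induction m with
  | zero => simpa using .const hD 0
  | succ m ih => simpa [add_smul] using ih.add ht
  | pred m ih => simpa only [sub_eq_add_neg, add_smul, neg_smul, one_smul] using ih.add ht.neg

lemma HasAnalyticGraph.sum (hD : AnalyticSet D) {ι : Type*} (I : Finset ι) {t : ι → X → B}
    (ht : ∀ i, c.HasAnalyticGraph D (t i)) : c.HasAnalyticGraph D fun x ↦ ∑ i ∈ I, t i x := by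
  classical
  induction I using Finset.induction_on with
  | empty => simpa using .const hD 0
  | insert i I hi ih => simpa [Finset.sum_insert hi] using (ht i).add ih

lemma HasAnalyticGraph.analyticSet_eq_zero {t : X → B} (ht : c.HasAnalyticGraph D t) :
    AnalyticSet {x ∈ D | t x = 0} := by
  obtain ⟨o, ho, ho0⟩ := c.surj 0
  have h := ht.preimage (f := fun x : X ↦ (x, o)) (by fun_prop)
  refine (congrArg AnalyticSet ?_).mp h
  ext x
  simp [ho, ho0]

variable (c)

/-- The codes of the tuples satisfying a given relation form an analytic set. -/
lemma analyticSet_sat {n : ℕ} (τ : ℤ × (Fin n → ℤ) × B) :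
    AnalyticSet {x : Fin n → Cantor | (∀ i, x i ∈ c.Bstar) ∧ Sat (fun i ↦ c.q (x i)) τ} := by
  let D : Set ((Fin n → Cantor) × Cantor) := {p | (∀ i, p.1 i ∈ c.Bstar) ∧ p.2 ∈ c.Bstar}
  have hD : AnalyticSet D := by
    have h := AnalyticSet.iInter (ι := Option (Fin n))
      (s := fun i ↦ i.elim {p : (Fin n → Cantor) × Cantor | p.2 ∈ c.Bstar}
        fun i ↦ {p | p.1 i ∈ c.Bstar}) (by
      rintro (_ | i)
      · exact c.analytic_Bstar.preimage continuous_snd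
      · exact c.analytic_Bstar.preimage ((continuous_apply i).comp continuous_fst))
    refine (congrArg AnalyticSet ?_).mp h
    ext p
    simp [D, Option.forall, and_comm]
  have hs : c.HasAnalyticGraph D fun p ↦ ∑ i, τ.2.1 i • c.q (p.1 i) :=
    .sum hD _ fun i ↦ .zsmul hD (.comp_q hD (by fun_prop) fun p hp ↦ hp.1 i) _
  have ht : c.HasAnalyticGraph D fun p ↦ τ.1 • c.q p.2 + τ.2.2 :=
    .add (.zsmul hD (.comp_q hD continuous_snd fun p hp ↦ hp.2) _) (.const hD _)
  have h := (hs.add ht.neg).analyticSet_eq_zero.image_of_continuous continuous_fst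
  refine (congrArg AnalyticSet ?_).mp h
  ext x
  constructor
  · rintro ⟨p, ⟨hp, h0⟩, rfl⟩
    exact ⟨hp.1, c.q p.2, add_neg_eq_zero.1 h0⟩
  · rintro ⟨hx, y, hy⟩
    obtain ⟨z, hz, rfl⟩ := c.surj y
    exact ⟨(x, z), ⟨⟨hx, hz⟩, add_neg_eq_zero.2 hy⟩, rfl⟩

end SouslinCode

end Analytic

section Whitehead

universe u v w

lemma continuum_eq_aleph_one_of_lift
    (h : (2 : Cardinal.{v}) ^ Cardinal.aleph 0 = Cardinal.aleph 1) :
    (𝔠 : Cardinal.{u}) = ℵ₁ := by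
  rw [aleph_zero, two_power_aleph0] at h
  rw [← lift_inj.{u, v}]
  simpa using congrArg lift.{u, v} h

lemma SouslinCode.mk_le_continuum {B : Type u} [AddCommGroup B] (c : SouslinCode B) : #B ≤ 𝔠 := by
  have hs : Function.Surjective c.q := fun b ↦ (c.surj b).imp fun _ h ↦ h.2
  have := mk_le_of_surjective (f := c.q ∘ ULift.down.{u}) (hs.comp ULift.down_surjective)
  simpa using this

lemma IsWhitehead.liftsCharacters {B : Type u} [AddCommGroup B] [Small.{0} B]
    (h : IsWhitehead.{u, w} B) : LiftsCharacters B := by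
  intro χ
  let e : Shrink.{0} B ≃+ B := Shrink.addEquiv
  let P : AddSubgroup (Shrink.{0} B × ℚ) :=
    ((χ.comp e.toAddMonoidHom).comp (AddMonoidHom.fst _ _) -
      (QuotientAddGroup.mk' (AddSubgroup.zmultiples (1 : ℚ))).comp (AddMonoidHom.snd _ _)).ker
  have hP : ∀ p, p ∈ P ↔ χ (e p.1) = (p.2 : AddCircle (1 : ℚ)) := fun p ↦ by
    rw [AddMonoidHom.mem_ker, AddMonoidHom.sub_apply, sub_eq_zero]
    rfl
  let f : ULift.{w} P →+ B := e.toAddMonoidHom.comp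
    ((AddMonoidHom.fst _ _).comp (P.subtype.comp AddEquiv.ulift.toAddMonoidHom))
  have hf : ∀ p, f p = e p.down.1.1 := fun _ ↦ rfl
  have hsurj : Function.Surjective f := by
    intro b
    obtain ⟨y, hy⟩ := QuotientAddGroup.mk_surjective (χ b)
    exact ⟨⟨(e.symm b, y), (hP _).2 (by simpa using hy.symm)⟩, by simp [hf]⟩
  have hker : Nonempty (f.ker ≃+ ℤ) := by
    have hz : ∀ z : ℤ, ((0, (z : ℚ)) : Shrink.{0} B × ℚ) ∈ P := fun z ↦ by
      rw [hP, map_zero, map_zero, eq_comm, coe_eq_zero_iff_int]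
      exact ⟨z, rfl⟩
    let g : ℤ →+ f.ker := AddMonoidHom.mk' (fun z ↦ ⟨⟨⟨(0, z), hz z⟩⟩, by simp [hf]⟩)
      fun a b ↦ by
        refine Subtype.ext (ULift.ext _ _ (Subtype.ext ?_))
        simp
    refine ⟨(AddEquiv.ofBijective g ⟨fun a b hab ↦ ?_, ?_⟩).symm⟩
    · have := congrArg (fun p : f.ker ↦ p.1.down.1.2) hab
      simpa [g] using this
    · rintro ⟨⟨⟨⟨b, y⟩, hp⟩⟩, hk⟩
      have hb : b = 0 := by
        rw [AddMonoidHom.mem_ker, hf] at hk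
        simpa using hk
      subst hb
      rw [hP, map_zero, map_zero, eq_comm, coe_eq_zero_iff_int] at hp
      obtain ⟨z, rfl⟩ := hp
      exact ⟨z, rfl⟩
  obtain ⟨s, hs⟩ := h (ULift.{w} P) f hsurj hker
  refine ⟨(AddMonoidHom.snd _ _).comp ((P.subtype.comp AddEquiv.ulift.toAddMonoidHom).comp s),
    fun b ↦ ?_⟩
  have h₁ := (hP _).1 (s b).down.2
  have h₂ : f (s b) = b := DFunLike.congr_fun hs b
  rw [← hf, h₂] at h₁
  exact h₁.symm

end Whitehead

section Limit

open Filter Topology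

variable {B : Type*} [AddCommGroup B]

/-- Continuous parametrizations of countably many analytic sets have a common value at
approximable parameters. -/
lemma exists_common_value {X T : Type*} [TopologicalSpace X] [T2Space X]
    {F : T → (ℕ → ℕ) → X} {τ : ℕ → T} {w : ℕ → ℕ → ℕ} (hF : ∀ j, Continuous (F (τ j)))
    (x : ℕ → X) (w' : ℕ → ℕ → ℕ → ℕ)
    (hx : ∀ j, ∀ᶠ N in atTop, F (τ j) (w' N j) = x N)
    (hw : ∀ j m, ∀ᶠ N in atTop, w' N j m = w j m) :
    ∃ y, ∀ j, F (τ j) (w j) = y := by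
  have h : ∀ j, Tendsto x atTop (𝓝 (F (τ j) (w j))) := fun j ↦ by
    have hwj : Tendsto (fun N ↦ w' N j) atTop (𝓝 (w j)) :=
      tendsto_pi_nhds.2 fun m ↦ tendsto_nhds_of_eventually_eq (hw j m)
    exact (((hF j).tendsto _).comp hwj).congr' (hx j)
  exact ⟨F (τ 0) (w 0), fun j ↦ tendsto_nhds_unique (h j) (h 0)⟩

theorem SouslinCode.isNonstationary_badSubgroups (c : SouslinCode B) (hl : LiftsCharacters B)
    (hR : ∀ A : AddSubgroup B, (A : Set B).Countable → (intRadical A).Countable) :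
    IsNonstationary (badSubgroups B) := by
  refine (IsNonstationary.iUnion (𝒮 := fun n ↦ {A | ∃ x : Fin n → B, ExcludesAll A x ∧
    ∃ i, x i ∉ A}) fun n ↦ ?_).mono fun A hA ↦ ?_
  swap
  · have := hA.2
    simp only [NoExcludedTuples] at this
    push Not at this
    exact Set.mem_iUnion.2 this
  set 𝒮 : Set (AddSubgroup B) := {A | ∃ x : Fin n → B, ExcludesAll A x ∧ ∃ i, x i ∉ A} with h𝒮
  let V (t : ℤ × (Fin n → ℤ) × B) : Set (Fin n → Cantor) :=
    {x | (∀ i, x i ∈ c.Bstar) ∧ Sat (fun i ↦ c.q (x i)) t}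
  have hV : ∀ t, ∃ F : (ℕ → ℕ) → (Fin n → Cantor), (V t).Nonempty →
      Continuous F ∧ Set.range F = V t := by
    intro t
    have hA := c.analyticSet_sat t
    rw [AnalyticSet] at hA
    rcases hA with h | ⟨F, hF⟩
    · exact ⟨fun _ _ _ ↦ true, fun hne ↦ (hne.ne_empty h).elim⟩
    · exact ⟨F, fun _ ↦ hF⟩
  choose F hF using hV
  choose code hcode hq using c.surj
  obtain ⟨k, hk⟩ := exists_surjective_nat (Fin n → ℤ)
  have hdata : ∀ A, ∃ (x : Fin n → B) (τ : ℕ → ℤ × (Fin n → ℤ) × B) (w : ℕ → ℕ → ℕ), A ∈ 𝒮 →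
      (∃ i, x i ∉ A) ∧ ∀ j, (τ j).2.2 ∈ A ∧ Sat x (τ j) ∧
        (k j ≠ 0 → ¬(τ j).1 ∣ ∑ i, (τ j).2.1 i * k j i) ∧
        F (τ j) (w j) = fun i ↦ code (x i) := by
    intro A
    by_cases hA : A ∈ 𝒮
    swap
    · exact ⟨0, 0, 0, fun h ↦ (hA h).elim⟩
    obtain ⟨x, hx, hxA⟩ := hA
    have hτ : ∀ j, ∃ t : ℤ × (Fin n → ℤ) × B, t.2.2 ∈ A ∧ Sat x t ∧
        (k j ≠ 0 → ¬t.1 ∣ ∑ i, t.2.1 i * k j i) := by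
      intro j
      by_cases hj : k j = 0
      · exact ⟨0, A.zero_mem, ⟨0, by simp⟩, fun h ↦ (h hj).elim⟩
      · obtain ⟨t, h₁, h₂, h₃⟩ := hx (k j) hj
        exact ⟨t, h₁, h₃, fun _ ↦ h₂⟩
    choose τ h₁ h₂ h₃ using hτ
    have hw : ∀ j, ∃ w, F (τ j) w = fun i ↦ code (x i) := by
      intro j
      have hmem : (fun i ↦ code (x i)) ∈ V (τ j) :=
        ⟨fun i ↦ hcode _, by simpa only [hq] using h₂ j⟩
      have := (hF (τ j) ⟨_, hmem⟩).2 ▸ hmem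
      exact this
    choose w hw using hw
    exact ⟨x, τ, w, fun _ ↦ ⟨hxA, fun j ↦ ⟨h₁ j, h₂ j, h₃ j, hw j⟩⟩⟩
  choose x τ w hdata using hdata
  let S : BadFamily B n :=
    { carrier := 𝒮
      x := x
      k := k
      τ := τ
      v := fun A i ↦ w A i.unpair.1 i.unpair.2
      k_surjective := hk
      exists_notMem := fun A hA ↦ (hdata A hA).1
      mem := fun A hA j ↦ ((hdata A hA).2 j).1
      sat := fun A hA j ↦ ((hdata A hA).2 j).2.1
      not_dvd := fun A hA j ↦ ((hdata A hA).2 j).2.2.1 }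
  refine S.isNonstationary_carrier hl hR fun τ' v' happrox ↦ ?_
  choose A hA hAτ using happrox
  have hτ : ∀ j N, j < N → τ (A N) j = τ' j := fun j N hj ↦ (hAτ N j hj).1
  have hne : ∀ j, (V (τ' j)).Nonempty := by
    intro j
    rw [← hτ j (j + 1) (Nat.lt_succ_self j)]
    obtain ⟨-, hs, -⟩ := (hdata _ (hA (j + 1))).2 j
    exact ⟨fun i ↦ code (x _ i), fun i ↦ hcode _, by simpa only [hq] using hs⟩
  obtain ⟨y, hy⟩ := exists_common_value (F := F) (τ := τ') (w := fun j m ↦ v' (Nat.pair j m))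
    (fun j ↦ (hF _ (hne j)).1) (fun N i ↦ code (x (A N) i)) (fun N ↦ w (A N))
    (fun j ↦ (eventually_gt_atTop j).mono fun N hN ↦ by
      rw [← hτ j N hN]
      exact ((hdata _ (hA N)).2 j).2.2.2)
    (fun j m ↦ (eventually_gt_atTop (Nat.pair j m)).mono fun N hN ↦ by
      simpa [S] using (hAτ N _ hN).2)
  refine ⟨fun i ↦ c.q (y i), fun j ↦ ?_⟩
  have : y ∈ V (τ' j) := by
    rw [← (hF _ (hne j)).2, ← hy j]
    exact Set.mem_range_self _
  exact this.2

end Limit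

/-- Assuming the continuum hypothesis, every Souslin Whitehead group is free. -/
theorem souslin_whitehead_free_of_CH
    (hch : (2 : Cardinal) ^ Cardinal.aleph 0 = Cardinal.aleph 1)
    (B : Type*) [AddCommGroup B] (hcode : HasSouslinCode B) (hwh : IsWhitehead B) :
    Module.Free ℤ B := by
  obtain ⟨c⟩ := hcode
  have hs : Function.Surjective c.q := fun b ↦ (c.surj b).imp fun _ h ↦ h.2
  have : Small.{0} B := small_of_surjective hs
  have hl := hwh.liftsCharacters
  have h𝔠 := continuum_eq_aleph_one_of_lift hch
  exact free_of_isNonstationary_badSubgroups (c.mk_le_continuum.trans h𝔠.le) hl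
    (c.isNonstationary_badSubgroups hl fun _ hA ↦ hl.countable_intRadical h𝔠 hA)
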